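/- arXiv:2305.06306 — 5 statements merged into one kernel-verified Lean document; each statement's English description precedes it below -/
import Mathlib

section
/- Let k ≥ 2 and s ≥ 4. There exists P_0 (depending on s and k) such that for every prime p ≥ P_0, the density δ_p = lim_{A→∞} #{tuples a of nonzero integers with |a| ≤ A and a ∈ C_p(k,s)}/(2A)^s exists and equals 1 − (1 − p^{−s})^{−1}·( s·(1 − 1/p)·p^{−(s−1)} + (s(s−1)/2)·(1 − 1/p)²·(1 − g_{p,k}^{−1})·p^{−(s−2)} ), where g_{p,k} = gcd(p−1, k). -/
open scoped BigOperators Classical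
open Filter

noncomputable section

/-- `hgt a = max_j |a_j|` as a real number. -/
def hgt {s : ℕ} (a : Fin s → ℤ) : ℝ :=
  ((Finset.univ.sup fun j => (a j).natAbs : ℕ) : ℝ)

/-- Solubility of `∑ a_j x_j^k = 0` in positive reals. -/
def solRplus (k : ℕ) {s : ℕ} (a : Fin s → ℤ) : Prop :=
  ∃ x : Fin s → ℝ, (∀ j, 0 < x j) ∧ ∑ j, (a j : ℝ) * x j ^ k = 0

/-- Solubility of `∑ a_j x_j^k = 0` in `p`-adic units. -/
def solZpUnit (k : ℕ) {s : ℕ} (p : ℕ) [Fact p.Prime] (a : Fin s → ℤ) : Prop :=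
  ∃ x : Fin s → ℤ_[p], (∀ j, IsUnit (x j)) ∧ ∑ j, (a j : ℤ_[p]) * x j ^ k = 0

/-- `a ∈ C'(k,s)`: real-positive solubility together with solubility in `p`-adic
units for every prime `p`. -/
def memC' (k : ℕ) {s : ℕ} (a : Fin s → ℤ) : Prop :=
  solRplus k a ∧ ∀ (p : ℕ) [Fact p.Prime], solZpUnit k p a

section PowerSums

variable {p : ℕ} [Fact p.Prime]

lemma card_units_pow_eq_le {k : ℕ} (hk : 0 < k) (c : ZMod p) :
    (Finset.univ.filter fun x : (ZMod p)ˣ => (x : ZMod p) ^ k = c).card ≤ k := by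
  refine le_trans ?_ (Polynomial.card_nthRoots k c)
  refine le_trans ?_ (Multiset.toFinset_card_le _)
  refine Finset.card_le_card_of_injOn (fun x : (ZMod p)ˣ => (x : ZMod p)) ?_ ?_
  · intro x hx
    simpa [Polynomial.mem_nthRoots hk] using hx
  · intro x _ y _ h
    exact Units.ext h

/-- The exponential sum `∑ ψ(t x^k)` over the nonzero residues `x`. -/
def unitPowSum (k : ℕ) (t : ZMod p) : ℂ :=
  ∑ x : (ZMod p)ˣ, ZMod.stdAddChar (t * (x : ZMod p) ^ k)

lemma unitPowSum_mul_pow (k : ℕ) (t : ZMod p) (u : (ZMod p)ˣ) :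
    unitPowSum k (t * (u : ZMod p) ^ k) = unitPowSum k t := by
  unfold unitPowSum
  refine Fintype.sum_equiv (Equiv.mulLeft u) _ _ fun x => ?_
  simp [mul_pow, mul_assoc]

lemma unitPowSum_zero (k : ℕ) : unitPowSum k (0 : ZMod p) = (p : ℂ) - 1 := by
  have h1 : 1 ≤ p := (Fact.out : p.Prime).one_le
  simp [unitPowSum, ZMod.card_units_eq_totient, Nat.totient_prime (Fact.out : p.Prime), h1]

lemma sum_norm_sq_unitPowSum {k : ℕ} (hk : 0 < k) :
    ∑ t : ZMod p, ‖unitPowSum k t‖ ^ 2 ≤ (p : ℝ) * ((p - 1) * k) := by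
  have h1 : 1 ≤ p := (Fact.out : p.Prime).one_le
  have key : ((∑ t : ZMod p, ‖unitPowSum k t‖ ^ 2 : ℝ) : ℂ) =
      (p : ℂ) * ∑ y : (ZMod p)ˣ, ((Finset.univ.filter
        fun x : (ZMod p)ˣ => (x : ZMod p) ^ k = (y : ZMod p) ^ k).card : ℂ) := by
    push_cast
    have h (t : ZMod p) : ((‖unitPowSum k t‖ : ℂ)) ^ 2 = ∑ y : (ZMod p)ˣ, ∑ x : (ZMod p)ˣ,
        ZMod.stdAddChar (t * ((x : ZMod p) ^ k - (y : ZMod p) ^ k)) := by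
      rw [← Complex.mul_conj', mul_comm, unitPowSum, map_sum, Finset.sum_mul_sum]
      refine Finset.sum_congr rfl fun y _ => Finset.sum_congr rfl fun x _ => ?_
      rw [← AddChar.map_neg_eq_conj, ← AddChar.map_add_eq_mul]
      congr 1
      ring
    simp_rw [h]
    rw [Finset.sum_comm, Finset.mul_sum]
    refine Finset.sum_congr rfl fun y _ => ?_
    rw [Finset.sum_comm]
    simp_rw [AddChar.sum_mulShift _ (ZMod.isPrimitive_stdAddChar p), sub_eq_zero, ZMod.card]
    rw [Finset.card_filter]
    push_cast
    rw [Finset.mul_sum]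
    simp
  have key' : (∑ t : ZMod p, ‖unitPowSum k t‖ ^ 2 : ℝ) =
      (p : ℝ) * ∑ y : (ZMod p)ˣ, ((Finset.univ.filter
        fun x : (ZMod p)ˣ => (x : ZMod p) ^ k = (y : ZMod p) ^ k).card : ℝ) := by
    exact_mod_cast key
  rw [key']
  gcongr
  calc _ ≤ ∑ y : (ZMod p)ˣ, (k : ℝ) := by
        gcongr with y
        exact card_units_pow_eq_le hk _
    _ = _ := by
        simp [ZMod.card_units_eq_totient, Nat.totient_prime (Fact.out : p.Prime), h1]

lemma norm_sq_unitPowSum_le {k : ℕ} (hk : 0 < k) {t : ZMod p} (ht : t ≠ 0) :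
    ‖unitPowSum k t‖ ^ 2 ≤ (k : ℝ) ^ 2 * p := by
  have h2 : 2 ≤ p := (Fact.out : p.Prime).two_le
  have h2' : (2 : ℝ) ≤ p := by exact_mod_cast h2
  have h1 : 1 ≤ p := by lia
  have e1 : ∑ u : (ZMod p)ˣ, ‖unitPowSum k (t * (u : ZMod p) ^ k)‖ ^ 2
      = ((p : ℝ) - 1) * ‖unitPowSum k t‖ ^ 2 := by
    simp [unitPowSum_mul_pow, ZMod.card_units_eq_totient,
      Nat.totient_prime (Fact.out : p.Prime), h1]
  have e2 : ∑ u : (ZMod p)ˣ, ‖unitPowSum k (t * (u : ZMod p) ^ k)‖ ^ 2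
      ≤ k * ∑ v : ZMod p, ‖unitPowSum k v‖ ^ 2 := by
    rw [← Finset.sum_fiberwise_of_maps_to (s := Finset.univ) (t := Finset.univ)
      (g := fun u : (ZMod p)ˣ => t * (u : ZMod p) ^ k) (by simp), Finset.mul_sum]
    refine Finset.sum_le_sum fun v _ => ?_
    rw [Finset.sum_congr rfl (g := fun _ => ‖unitPowSum k v‖ ^ 2)
      (fun u hu => by rw [(Finset.mem_filter.1 hu).2])]
    rw [Finset.sum_const, nsmul_eq_mul]
    gcongr
    refine le_trans (le_of_eq ?_) (card_units_pow_eq_le (p := p) hk (t⁻¹ * v))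
    congr 1
    ext u
    simp [eq_inv_mul_iff_mul_eq₀ ht]
  have e3 := sum_norm_sq_unitPowSum (p := p) hk
  have e4 : ((p : ℝ) - 1) * ‖unitPowSum k t‖ ^ 2 ≤ (p - 1) * ((k : ℝ) ^ 2 * p) := by
    rw [← e1]
    refine e2.trans ((mul_le_mul_of_nonneg_left e3 (by positivity)).trans (le_of_eq ?_))
    ring
  exact le_of_mul_le_mul_left e4 (by linarith)

lemma exists_units_sum_three_pow {k : ℕ} (hk : 0 < k) (hp : 8 * k ^ 6 + 2 ≤ p)
    {a b c : ZMod p} (ha : a ≠ 0) (hb : b ≠ 0) (hc : c ≠ 0) (d : ZMod p) :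
    ∃ x y z : (ZMod p)ˣ,
      a * (x : ZMod p) ^ k + b * (y : ZMod p) ^ k + c * (z : ZMod p) ^ k = d := by
  by_contra! hcon
  have h2 : 2 ≤ p := (Fact.out : p.Prime).two_le
  have h2' : (2 : ℝ) ≤ p := by exact_mod_cast h2
  have hp' : (8 * k ^ 6 + 2 : ℝ) ≤ p := by exact_mod_cast hp
  set F : ZMod p → ℂ := fun t => ZMod.stdAddChar (-(t * d)) *
    (unitPowSum k (t * a) * unitPowSum k (t * b) * unitPowSum k (t * c)) with hF
  have hsum : ∑ t, F t = 0 := by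
    have h (t : ZMod p) : F t = ∑ z : (ZMod p)ˣ, ∑ y : (ZMod p)ˣ, ∑ x : (ZMod p)ˣ,
        ZMod.stdAddChar (t * (a * (x : ZMod p) ^ k + b * (y : ZMod p) ^ k
          + c * (z : ZMod p) ^ k - d)) := by
      simp only [hF, unitPowSum, Finset.sum_mul, Finset.mul_sum]
      refine Finset.sum_congr rfl fun z _ => Finset.sum_congr rfl fun y _ =>
        Finset.sum_congr rfl fun x _ => ?_
      simp only [← AddChar.map_add_eq_mul]
      congr 1
      ring
    simp_rw [h]
    rw [Finset.sum_comm]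
    refine Finset.sum_eq_zero fun z _ => ?_
    rw [Finset.sum_comm]
    refine Finset.sum_eq_zero fun y _ => ?_
    rw [Finset.sum_comm]
    refine Finset.sum_eq_zero fun x _ => ?_
    rw [AddChar.sum_mulShift _ (ZMod.isPrimitive_stdAddChar p), if_neg]
    · simp
    · exact sub_ne_zero.2 (hcon x y z)
  have hF0 : F 0 = ((p : ℂ) - 1) ^ 3 := by
    simp only [hF, zero_mul, unitPowSum_zero, neg_zero, AddChar.map_zero_eq_one]
    ring
  have hFt (t : ZMod p) (ht : t ≠ 0) : ‖F t‖ ≤ Real.sqrt ((k : ℝ) ^ 2 * p) ^ 3 := by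
    have hS (e : ZMod p) (he : e ≠ 0) :
        ‖unitPowSum k (t * e)‖ ≤ Real.sqrt ((k : ℝ) ^ 2 * p) :=
      Real.le_sqrt_of_sq_le (norm_sq_unitPowSum_le hk (mul_ne_zero ht he))
    simp only [hF, norm_mul, AddChar.norm_apply, one_mul]
    calc _ ≤ Real.sqrt ((k : ℝ) ^ 2 * p) * Real.sqrt ((k : ℝ) ^ 2 * p)
          * Real.sqrt ((k : ℝ) ^ 2 * p) := by
          gcongr
          exacts [hS a ha, hS b hb, hS c hc]
      _ = _ := by ring
  rw [← Finset.add_sum_erase _ _ (Finset.mem_univ (0 : ZMod p)), hF0] at hsum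
  have hle : ((p : ℝ) - 1) ^ 3 ≤ (p - 1) * Real.sqrt ((k : ℝ) ^ 2 * p) ^ 3 := by
    have e1 : ((p : ℝ) - 1) ^ 3 = ‖∑ t ∈ Finset.univ.erase 0, F t‖ := by
      rw [eq_neg_of_add_eq_zero_right hsum, norm_neg, norm_pow]
      congr 1
      rw [show (p : ℂ) - 1 = ((p - 1 : ℝ) : ℂ) by push_cast; rfl, Complex.norm_real,
        Real.norm_of_nonneg (by linarith)]
    rw [e1]
    refine (norm_sum_le _ _).trans ?_
    refine (Finset.sum_le_card_nsmul _ _ _ fun t ht => hFt t (Finset.ne_of_mem_erase ht)).trans ?_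
    rw [nsmul_eq_mul, Finset.card_erase_of_mem (Finset.mem_univ _), Finset.card_univ, ZMod.card,
      Nat.cast_sub (by lia), Nat.cast_one]
  set q : ℝ := (p : ℝ) - 1 with hq
  set r := Real.sqrt ((k : ℝ) ^ 2 * p)
  have hr0 : 0 ≤ r := Real.sqrt_nonneg _
  have hr2 : r ^ 2 = (k : ℝ) ^ 2 * p := Real.sq_sqrt (by positivity)
  have hq0 : 0 < q := by linarith
  have h3 : q ^ 2 ≤ r ^ 3 := by
    refine le_of_mul_le_mul_left ?_ hq0
    linarith [hle, pow_succ q 2, mul_comm (q ^ 2) q]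
  have h4 : q ^ 4 ≤ (k : ℝ) ^ 6 * p ^ 3 := by
    calc q ^ 4 = (q ^ 2) ^ 2 := by ring
      _ ≤ (r ^ 3) ^ 2 := by gcongr
      _ = (r ^ 2) ^ 3 := by ring
      _ = _ := by rw [hr2]; ring
  have h5 : (p : ℝ) ^ 3 ≤ 8 * q ^ 3 := by
    calc (p : ℝ) ^ 3 ≤ (2 * q) ^ 3 := by gcongr; linarith
      _ = _ := by ring
  have h6 : q * q ^ 3 ≤ (8 * k ^ 6) * q ^ 3 := by
    calc q * q ^ 3 = q ^ 4 := by ring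
      _ ≤ (k : ℝ) ^ 6 * p ^ 3 := h4
      _ ≤ (k : ℝ) ^ 6 * (8 * q ^ 3) := by gcongr
      _ = _ := by ring
  have h7 := le_of_mul_le_mul_right h6 (by positivity)
  linarith

end PowerSums

section Residues

variable {p : ℕ} [Fact p.Prime] {s : ℕ}

lemma toZMod_eq_zero_iff_norm_lt_one (z : ℤ_[p]) : PadicInt.toZMod z = 0 ↔ ‖z‖ < 1 := by
  rw [← RingHom.mem_ker, PadicInt.ker_toZMod, IsLocalRing.mem_maximalIdeal,
    PadicInt.mem_nonunits]

lemma isUnit_iff_toZMod_ne_zero (z : ℤ_[p]) : IsUnit z ↔ PadicInt.toZMod z ≠ 0 := by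
  rw [Ne, toZMod_eq_zero_iff_norm_lt_one, PadicInt.isUnit_iff]
  have := PadicInt.norm_le_one z
  constructor
  · intro h; simp [h]
  · intro h; exact le_antisymm this (not_lt.1 h)

/-- Solubility of `∑ b_j x_j^k = 0` in nonzero residues modulo `p`. -/
def SolubleModUnits (k : ℕ) (b : Fin s → ZMod p) : Prop :=
  ∃ x : Fin s → (ZMod p)ˣ, ∑ j, b j * (x j : ZMod p) ^ k = 0

lemma solZpUnit.solubleModUnits {k : ℕ} {a : Fin s → ℤ} (h : solZpUnit k p a) :
    SolubleModUnits k (fun j => (a j : ZMod p)) := by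
  obtain ⟨x, hx, h0⟩ := h
  refine ⟨fun j => ((hx j).map PadicInt.toZMod).unit, ?_⟩
  simpa using congrArg PadicInt.toZMod h0

lemma SolubleModUnits.solZpUnit {k : ℕ} (hkp : ¬ p ∣ k) {a : Fin s → ℤ}
    (ha : (fun j => (a j : ZMod p)) ≠ 0) (h : SolubleModUnits k (fun j => (a j : ZMod p))) :
    solZpUnit k p a := by
  obtain ⟨x, hx⟩ := h
  obtain ⟨i, hi⟩ := Function.ne_iff.1 ha
  have hi : (a i : ZMod p) ≠ 0 := hi
  choose y hy using fun j => ZMod.ringHom_surjective (PadicInt.toZMod (p := p)) (x j : ZMod p)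
  obtain ⟨S, hS⟩ : ∃ S, S = ∑ j ∈ Finset.univ.erase i, (a j : ℤ_[p]) * y j ^ k := ⟨_, rfl⟩
  set F : Polynomial ℤ_[p] :=
    Polynomial.C (a i : ℤ_[p]) * Polynomial.X ^ k + Polynomial.C S with hF
  have hFev (z : ℤ_[p]) : F.aeval z = (a i : ℤ_[p]) * z ^ k + S := by
    simp [hF]
  have hFder (z : ℤ_[p]) :
      F.derivative.aeval z = (a i : ℤ_[p]) * ((k : ℤ_[p]) * z ^ (k - 1)) := by
    simp [hF, Polynomial.derivative_X_pow]
  have hlt : ‖F.aeval (y i)‖ < 1 := by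
    rw [← toZMod_eq_zero_iff_norm_lt_one, hFev, hS,
      Finset.add_sum_erase _ (fun j => (a j : ℤ_[p]) * y j ^ k) (Finset.mem_univ i)]
    simpa [hy] using hx
  have hder : ‖F.derivative.aeval (y i)‖ = 1 := by
    rw [← PadicInt.isUnit_iff, isUnit_iff_toZMod_ne_zero, hFder]
    have hk0 : (k : ZMod p) ≠ 0 := by rwa [Ne, ZMod.natCast_eq_zero_iff]
    simp [hy, hi, hk0]
  obtain ⟨z, hz0, hz1, -, -⟩ := hensels_lemma (F := F) (a := y i) (by rw [hder]; simpa using hlt)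
  rw [hder, ← toZMod_eq_zero_iff_norm_lt_one, map_sub, sub_eq_zero, hy] at hz1
  refine ⟨Function.update y i z, fun j => ?_, ?_⟩
  · rw [isUnit_iff_toZMod_ne_zero]
    by_cases hj : j = i
    · subst hj; simp [hz1]
    · simp [hj, hy]
  · rw [← Finset.add_sum_erase _ _ (Finset.mem_univ i), Function.update_self, ← hz0, hFev, hS]
    congr 1
    refine Finset.sum_congr rfl fun j hj => ?_
    rw [Function.update_of_ne (Finset.ne_of_mem_erase hj)]

lemma solZpUnit_mul_prime_iff (k : ℕ) (a : Fin s → ℤ) :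
    solZpUnit k p (fun j => (p : ℤ) * a j) ↔ solZpUnit k p a := by
  have hp0 : (p : ℤ_[p]) ≠ 0 := Nat.cast_ne_zero.2 (Fact.out : p.Prime).ne_zero
  unfold solZpUnit
  refine exists_congr fun x => and_congr_right fun _ => ?_
  simp [mul_assoc, ← Finset.mul_sum, hp0]

lemma solubleModUnits_of_two_lt_card {k : ℕ} (hk : 0 < k) (hp : 8 * k ^ 6 + 2 ≤ p)
    {b : Fin s → ZMod p} (hb : 2 < (Finset.univ.filter fun j => b j ≠ 0).card) :
    SolubleModUnits k b := by
  obtain ⟨i, j, l, hi, hj, hl, hij, hil, hjl⟩ := Finset.two_lt_card_iff.1 hb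
  simp only [Finset.mem_filter, Finset.mem_univ, true_and] at hi hj hl
  obtain ⟨x, y, z, h⟩ := exists_units_sum_three_pow hk hp hi hj hl
    (-∑ m ∈ ({i, j, l} : Finset (Fin s))ᶜ, b m)
  refine ⟨fun m => if m = i then x else if m = j then y else if m = l then z else 1, ?_⟩
  rw [← Finset.sum_add_sum_compl {i, j, l}, Finset.sum_insert (by simp [hij, hil]),
    Finset.sum_insert (by simp [hjl]), Finset.sum_singleton,
    Finset.sum_congr rfl (s₁ := ({i, j, l} : Finset (Fin s))ᶜ) (g := b)]
  · simp only [if_true, if_neg hij.symm, if_neg hil.symm, if_neg hjl.symm]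
    rw [← add_assoc, h]
    ring
  · intro m hm
    simp only [Finset.mem_compl, Finset.mem_insert, Finset.mem_singleton, not_or] at hm
    simp [hm.1, hm.2.1, hm.2.2]

/-- The vector with entries `u` at `i`, `-(u w)` at `j`, and `0` elsewhere. -/
def twoTermVector (i j : Fin s) (u w : (ZMod p)ˣ) : Fin s → ZMod p :=
  Pi.single i (u : ZMod p) + Pi.single j (-(u * w : ZMod p))

lemma solubleModUnits_twoTermVector_iff {k : ℕ} {i j : Fin s} (hij : i ≠ j)
    (u w : (ZMod p)ˣ) :
    SolubleModUnits k (twoTermVector i j u w) ↔ w ∈ (powMonoidHom k : (ZMod p)ˣ →* _).range := by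
  have hsum (x : Fin s → (ZMod p)ˣ) :
      ∑ l, twoTermVector i j u w l * (x l : ZMod p) ^ k =
        u * ((x i : ZMod p) ^ k - w * (x j : ZMod p) ^ k) := by
    simp only [twoTermVector, Pi.add_apply, add_mul, Finset.sum_add_distrib, Pi.single_apply,
      ite_mul, zero_mul, Finset.sum_ite_eq', Finset.mem_univ, if_true]
    ring
  simp only [SolubleModUnits, hsum, Units.mul_right_eq_zero, sub_eq_zero, MonoidHom.mem_range,
    powMonoidHom_apply]
  constructor
  · rintro ⟨x, hx⟩
    refine ⟨x i / x j, ?_⟩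
    rw [div_pow, div_eq_iff_eq_mul]
    exact Units.ext (by simpa using hx)
  · rintro ⟨z, rfl⟩
    refine ⟨fun l => if l = i then z else 1, ?_⟩
    simp [hij.symm]

/-- The nonzero residue vectors `b` for which `∑ b_j x_j^k = 0` has no solution in nonzero
residues. -/
def insolubleResidues (k s p : ℕ) [Fact p.Prime] : Finset (Fin s → ZMod p) :=
  Finset.univ.filter fun b => b ≠ 0 ∧ ¬ SolubleModUnits k b

lemma card_units_zmod : Fintype.card (ZMod p)ˣ = p - 1 := by
  rw [ZMod.card_units_eq_totient, Nat.totient_prime (Fact.out : p.Prime)]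

lemma card_not_pow (k : ℕ) :
    (((Finset.univ.filter fun w : (ZMod p)ˣ =>
      w ∉ (powMonoidHom k : (ZMod p)ˣ →* (ZMod p)ˣ).range).card : ℕ) : ℝ) =
      ((p : ℝ) - 1) * (1 - 1 / (Nat.gcd (p - 1) k : ℝ)) := by
  have h2 : 2 ≤ p := (Fact.out : p.Prime).two_le
  have h1 := Finset.card_filter_add_card_filter_not (s := (Finset.univ : Finset (ZMod p)ˣ))
    (fun w => w ∈ (powMonoidHom k : (ZMod p)ˣ →* (ZMod p)ˣ).range)
  have h3 : (Finset.univ.filter fun w : (ZMod p)ˣ =>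
      w ∈ (powMonoidHom k : (ZMod p)ˣ →* (ZMod p)ˣ).range).card
      = (p - 1) / Nat.gcd (p - 1) k := by
    have := IsCyclic.card_powMonoidHom_range (G := (ZMod p)ˣ) k
    rw [Nat.card_eq_fintype_card (α := (ZMod p)ˣ), card_units_zmod] at this
    rw [← this, Nat.card_eq_fintype_card, Fintype.card_subtype]
  rw [h3, Finset.card_univ, card_units_zmod] at h1
  have hg : (Nat.gcd (p - 1) k : ℝ) ≠ 0 :=
    Nat.cast_ne_zero.2 (Nat.gcd_pos_of_pos_left _ (by lia)).ne'
  have h4 := congrArg (Nat.cast (R := ℝ)) h1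
  rw [Nat.cast_add, Nat.cast_div (Nat.gcd_dvd_left _ _) hg, Nat.cast_sub (by lia),
    Nat.cast_one] at h4
  rw [eq_sub_of_add_eq' h4]
  ring

lemma card_insolubleResidues_support_singleton (k : ℕ) (i : Fin s) :
    ((insolubleResidues k s p).filter fun b =>
      (Finset.univ.filter fun j => b j ≠ 0) = {i}).card = p - 1 := by
  rw [← card_units_zmod (p := p), ← Finset.card_univ]
  symm
  refine Finset.card_bij (fun u _ => Pi.single i (u : ZMod p)) ?_ ?_ ?_
  · intro u _
    simp only [insolubleResidues, Finset.mem_filter, Finset.mem_univ, true_and]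
    refine ⟨⟨by simp, ?_⟩, ?_⟩
    · rintro ⟨x, hx⟩
      simp [Pi.single_apply] at hx
    · ext j
      simp [Pi.single_apply]
  · intro u _ v _ h
    exact Units.ext (Pi.single_injective i h)
  · intro b hb
    have hsupp := (Finset.mem_filter.1 hb).2
    have hmem (j : Fin s) : b j ≠ 0 ↔ j = i := by simpa using Finset.ext_iff.1 hsupp j
    refine ⟨Units.mk0 (b i) ((hmem i).2 rfl), Finset.mem_univ _, ?_⟩
    ext j
    by_cases hj : j = i
    · subst hj; simp
    · simp [hj, not_ne_iff.1 (mt (hmem j).1 hj)]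

lemma card_insolubleResidues_support_pair (k : ℕ) {i j : Fin s} (hij : i ≠ j) :
    (((insolubleResidues k s p).filter fun b =>
      (Finset.univ.filter fun l => b l ≠ 0) = {i, j}).card : ℝ) =
      ((p : ℝ) - 1) ^ 2 * (1 - 1 / (Nat.gcd (p - 1) k : ℝ)) := by
  have hbij : ((Finset.univ : Finset (ZMod p)ˣ) ×ˢ (Finset.univ.filter fun w : (ZMod p)ˣ =>
      w ∉ (powMonoidHom k : (ZMod p)ˣ →* (ZMod p)ˣ).range)).card =
      ((insolubleResidues k s p).filter fun b =>
        (Finset.univ.filter fun l => b l ≠ 0) = {i, j}).card := by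
    have hvi (u w : (ZMod p)ˣ) : twoTermVector i j u w i = u := by
      simp [twoTermVector, hij]
    have hvj (u w : (ZMod p)ˣ) : twoTermVector i j u w j = -(u * w) := by
      simp [twoTermVector, hij.symm]
    refine Finset.card_bij (fun q _ => twoTermVector i j q.1 q.2) ?_ ?_ ?_
    · rintro ⟨u, w⟩ hw
      simp only [Finset.mem_product, Finset.mem_filter, Finset.mem_univ, true_and] at hw
      simp only [insolubleResidues, Finset.mem_filter, Finset.mem_univ, true_and]
      refine ⟨⟨fun h => ?_, by rwa [solubleModUnits_twoTermVector_iff hij]⟩, ?_⟩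
      · have := congrFun h i
        rw [hvi] at this
        simp at this
      · ext l
        by_cases hl : l = i
        · subst hl; simp [hvi]
        by_cases hl' : l = j
        · subst hl'; simp [hvj]
        rw [Finset.mem_filter]
        simp [twoTermVector, hl, hl']
    · rintro ⟨u, w⟩ _ ⟨u', w'⟩ _ h
      have h : twoTermVector i j u w = twoTermVector i j u' w' := h
      have h1 := congrFun h i
      have h2 := congrFun h j
      rw [hvi, hvi] at h1
      obtain rfl := Units.ext h1
      rw [hvj, hvj] at h2
      obtain rfl : w = w' := Units.ext (by simpa using h2)
      rfl
    · intro b hb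
      obtain ⟨hins, hsupp⟩ := Finset.mem_filter.1 hb
      have hmem (l : Fin s) : b l ≠ 0 ↔ l = i ∨ l = j := by
        simpa using Finset.ext_iff.1 hsupp l
      have hi : b i ≠ 0 := (hmem i).2 (Or.inl rfl)
      have hj : b j ≠ 0 := (hmem j).2 (Or.inr rfl)
      obtain ⟨w, hbeq⟩ : ∃ w, b = twoTermVector i j (Units.mk0 (b i) hi) w := by
        refine ⟨Units.mk0 (-(b j) / b i) (div_ne_zero (neg_ne_zero.2 hj) hi), ?_⟩
        ext l
        by_cases hl : l = i
        · subst hl; simp [hvi]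
        by_cases hl' : l = j
        · subst hl'; rw [hvj]; simp only [Units.val_mk0]; field_simp
        have : b l = 0 := not_ne_iff.1 fun h => ((hmem l).1 h).elim hl hl'
        simp [twoTermVector, hl, hl', this]
      refine ⟨(_, _), ?_, hbeq.symm⟩
      simp only [Finset.mem_product, Finset.mem_filter, Finset.mem_univ, true_and]
      rw [← solubleModUnits_twoTermVector_iff hij (Units.mk0 (b i) hi), ← hbeq]
      exact (Finset.mem_filter.1 hins).2.2
  have h2 : 2 ≤ p := (Fact.out : p.Prime).two_le
  rw [← hbij, Finset.card_product, Nat.cast_mul, card_not_pow, Finset.card_univ, card_units_zmod,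
    Nat.cast_sub (by lia), Nat.cast_one]
  ring

lemma card_insolubleResidues {k : ℕ} (hk : 0 < k) (hp : 8 * k ^ 6 + 2 ≤ p) (s : ℕ) :
    ((insolubleResidues k s p).card : ℝ) = s * ((p : ℝ) - 1) +
      (s : ℝ) * ((s : ℝ) - 1) / 2 *
        (((p : ℝ) - 1) ^ 2 * (1 - 1 / (Nat.gcd (p - 1) k : ℝ))) := by
  have h2 : 2 ≤ p := (Fact.out : p.Prime).two_le
  set m : ℝ := ((p : ℝ) - 1) ^ 2 * (1 - 1 / (Nat.gcd (p - 1) k : ℝ)) with hm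
  have hfib (T : Finset (Fin s)) : (((insolubleResidues k s p).filter fun b =>
      (Finset.univ.filter fun l => b l ≠ 0) = T).card : ℝ) =
      (if T.card = 1 then ((p : ℝ) - 1) else 0) + (if T.card = 2 then m else 0) := by
    by_cases h1 : T.card = 1
    · obtain ⟨i, rfl⟩ := Finset.card_eq_one.1 h1
      rw [card_insolubleResidues_support_singleton, Nat.cast_sub (by lia)]
      simp
    by_cases h2 : T.card = 2
    · obtain ⟨i, j, hij, rfl⟩ := Finset.card_eq_two.1 h2
      rw [card_insolubleResidues_support_pair k hij]
      simp [h2, hm]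
    rw [if_neg h1, if_neg h2, add_zero, Nat.cast_eq_zero, Finset.card_eq_zero,
      Finset.filter_eq_empty_iff]
    rintro b hb rfl
    obtain ⟨hb0, hbs⟩ := (Finset.mem_filter.1 hb).2
    have h0 : (Finset.univ.filter fun l => b l ≠ 0).card ≠ 0 := by
      obtain ⟨i, hi⟩ := Function.ne_iff.1 hb0
      exact Finset.card_ne_zero_of_mem (a := i) (by simpa using hi)
    exact hbs (solubleModUnits_of_two_lt_card hk hp (by lia))
  have hcount (n : ℕ) (x : ℝ) :
      ∑ T : Finset (Fin s), (if T.card = n then x else 0) = (s.choose n : ℝ) * x := by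
    rw [← Finset.sum_filter, Finset.sum_const, nsmul_eq_mul, ← Finset.powerset_univ,
      ← Finset.powersetCard_eq_filter, Finset.card_powersetCard, Finset.card_univ,
      Fintype.card_fin]
  rw [Finset.card_eq_sum_card_fiberwise (t := Finset.univ)
    (f := fun b : Fin s → ZMod p => Finset.univ.filter fun l => b l ≠ 0) (by simp)]
  push_cast
  simp_rw [hfib]
  rw [Finset.sum_add_distrib, hcount, hcount, Nat.choose_one_right, Nat.cast_choose_two]

end Residues

section Density

/-- The nonzero integers of absolute value at most `A`. -/
def nonzeroInterval (A : ℝ) : Finset ℤ :=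
  (Finset.Icc (-(⌊A⌋₊ : ℤ)) ⌊A⌋₊).erase 0

/-- The vectors of nonzero integers of height at most `A`. -/
def nonzeroBox (s : ℕ) (A : ℝ) : Finset (Fin s → ℤ) :=
  Fintype.piFinset fun _ => nonzeroInterval A

lemma mem_nonzeroInterval {A : ℝ} {n : ℤ} :
    n ∈ nonzeroInterval A ↔ n ≠ 0 ∧ n.natAbs ≤ ⌊A⌋₊ := by
  rw [nonzeroInterval, Finset.mem_erase, Finset.mem_Icc]
  refine and_congr_right fun _ => ?_
  lia

lemma mem_nonzeroBox {s : ℕ} {A : ℝ} {a : Fin s → ℤ} :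
    a ∈ nonzeroBox s A ↔ ∀ j, a j ≠ 0 ∧ (a j).natAbs ≤ ⌊A⌋₊ := by
  simp [nonzeroBox, mem_nonzeroInterval]

lemma mem_nonzeroBox_iff_hgt {s : ℕ} {A : ℝ} (hA : 0 ≤ A) {a : Fin s → ℤ} :
    a ∈ nonzeroBox s A ↔ (∀ j, a j ≠ 0) ∧ hgt a ≤ A := by
  rw [mem_nonzeroBox, forall_and, hgt, ← Nat.le_floor_iff hA, Finset.sup_le_iff]
  simp

lemma card_nonzeroBox (s : ℕ) (A : ℝ) : (nonzeroBox s A).card = (2 * ⌊A⌋₊) ^ s := by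
  have h : (nonzeroInterval A).card = 2 * ⌊A⌋₊ := by
    rw [nonzeroInterval, Finset.card_erase_of_mem (by simp), Int.card_Icc]
    lia
  simp [nonzeroBox, Fintype.card_piFinset, h]

lemma abs_card_nonzeroInterval_residue_sub_le {p : ℕ} [Fact p.Prime] (r : ZMod p) {A : ℝ}
    (hA : 0 ≤ A) :
    |(((nonzeroInterval A).filter fun n : ℤ => (n : ZMod p) = r).card : ℝ) - 2 * A / p| ≤ 5 := by
  have hp2 : 2 ≤ p := (Fact.out : p.Prime).two_le
  have hp0 : (0 : ℝ) < p := by exact_mod_cast (by lia : 0 < p)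
  have hp1 : (1 : ℝ) ≤ p := by exact_mod_cast (by lia : 1 ≤ p)
  obtain ⟨v, rfl⟩ := ZMod.intCast_surjective r
  set N : ℤ := (⌊A⌋₊ : ℤ) with hN
  set S := (Finset.Ioc (-N - 1) N).filter fun n : ℤ => n ≡ v [ZMOD p] with hS
  have hNR : (N : ℝ) = (⌊A⌋₊ : ℝ) := by rw [hN]; simp
  have hNle : (N : ℝ) ≤ A := by rw [hNR]; exact Nat.floor_le hA
  have hNlt : A < N + 1 := by rw [hNR]; exact Nat.lt_floor_add_one A
  have hN0 : 0 ≤ N := by simp [hN]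
  have hset : (nonzeroInterval A).filter (fun n : ℤ => (n : ZMod p) = v) = S.erase 0 := by
    ext n
    simp only [nonzeroInterval, hS, Finset.mem_filter, Finset.mem_erase, Finset.mem_Icc,
      Finset.mem_Ioc, ZMod.intCast_eq_intCast_iff, ← hN]
    constructor
    · rintro ⟨⟨h1, h2, h3⟩, h4⟩; exact ⟨h1, ⟨by lia, h3⟩, h4⟩
    · rintro ⟨h1, ⟨h2, h3⟩, h4⟩; exact ⟨⟨h1, by lia, h3⟩, h4⟩
  have hc1 : (S.erase 0).card ≤ S.card := Finset.card_erase_le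
  have hc2 : S.card ≤ (S.erase 0).card + 1 := by
    have := Finset.pred_card_le_card_erase (s := S) (a := 0)
    lia
  have hcard : (S.card : ℤ) = max (⌊((N : ℤ) - v : ℚ) / ((p : ℤ) : ℚ)⌋ -
      ⌊(((-N - 1 : ℤ) : ℚ) - v) / ((p : ℤ) : ℚ)⌋) 0 :=
    Int.Ioc_filter_modEq_card _ _ (by lia) v
  set x : ℚ := ((N : ℤ) - v : ℚ) / ((p : ℤ) : ℚ) with hx
  set y : ℚ := (((-N - 1 : ℤ) : ℚ) - v) / ((p : ℤ) : ℚ) with hy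
  have hyx : y ≤ x := by
    rw [hx, hy]
    gcongr
    have : (0 : ℚ) ≤ N := by exact_mod_cast hN0
    linarith
  rw [max_eq_left (sub_nonneg.2 (Int.floor_le_floor hyx))] at hcard
  have hcQ : (S.card : ℚ) = (⌊x⌋ : ℚ) - ⌊y⌋ := by exact_mod_cast hcard
  have hb1 : (S.card : ℚ) ≤ x - y + 1 := by
    have := Int.floor_le x; have := Int.lt_floor_add_one y; linarith
  have hb2 : x - y - 1 ≤ (S.card : ℚ) := by
    have := Int.floor_le y; have := Int.lt_floor_add_one x; linarith
  have hxy : ((x - y : ℚ) : ℝ) = (2 * N + 1) / p := by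
    rw [hx, hy]; push_cast; ring
  have hb1' : (S.card : ℝ) ≤ (2 * N + 1) / p + 1 := by
    rw [← hxy]; exact_mod_cast hb1
  have hb2' : (2 * N + 1) / p - 1 ≤ (S.card : ℝ) := by
    rw [← hxy]; exact_mod_cast hb2
  have hd1 : ((2 * N + 1) / p : ℝ) ≤ 2 * A / p + 1 := by
    rw [← sub_le_iff_le_add', ← sub_div, div_le_one hp0]; linarith
  have hd2 : 2 * A / p ≤ ((2 * N + 1) / p : ℝ) + 1 := by
    rw [← sub_le_iff_le_add', ← sub_div, div_le_one hp0]; linarith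
  have hc1' : ((S.erase 0).card : ℝ) ≤ S.card := by exact_mod_cast hc1
  have hc2' : (S.card : ℝ) ≤ (S.erase 0).card + 1 := by exact_mod_cast hc2
  rw [hset, abs_le]
  constructor <;> linarith

lemma tendsto_card_nonzeroInterval_residue {p : ℕ} [Fact p.Prime] (r : ZMod p) :
    Tendsto (fun A : ℝ =>
      (((nonzeroInterval A).filter fun n : ℤ => (n : ZMod p) = r).card : ℝ) / (2 * A))
      atTop (nhds (1 / p)) := by
  rw [tendsto_iff_norm_sub_tendsto_zero]
  have h0 : Tendsto (fun A : ℝ => 5 / (2 * A)) atTop (nhds 0) :=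
    Tendsto.const_div_atTop (tendsto_id.const_mul_atTop two_pos) 5
  refine squeeze_zero' (Eventually.of_forall fun _ => norm_nonneg _) ?_ h0
  filter_upwards [eventually_gt_atTop 0] with A hA
  have h := abs_card_nonzeroInterval_residue_sub_le r hA.le
  rw [Real.norm_eq_abs, show (((nonzeroInterval A).filter fun n : ℤ => (n : ZMod p) = r).card : ℝ) /
    (2 * A) - 1 / p = ((((nonzeroInterval A).filter fun n : ℤ => (n : ZMod p) = r).card : ℝ) -
      2 * A / p) / (2 * A) by field_simp, abs_div, abs_of_pos (by positivity : 0 < 2 * A)]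
  gcongr

lemma tendsto_card_nonzeroBox_residues {p : ℕ} [Fact p.Prime] {s : ℕ}
    (R : Finset (Fin s → ZMod p)) :
    Tendsto (fun A : ℝ =>
      (((nonzeroBox s A).filter fun a => (fun j => (a j : ZMod p)) ∈ R).card : ℝ) / (2 * A) ^ s)
      atTop (nhds (R.card / (p : ℝ) ^ s)) := by
  have hcard (A : ℝ) :
      (((nonzeroBox s A).filter fun a => (fun j => (a j : ZMod p)) ∈ R).card : ℝ) / (2 * A) ^ s =
      ∑ r ∈ R, ∏ j : Fin s,
        ((((nonzeroInterval A).filter fun n : ℤ => (n : ZMod p) = r j).card : ℝ) / (2 * A)) := by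
    rw [Finset.card_eq_sum_card_fiberwise (t := R)
      (s := (nonzeroBox s A).filter fun a => (fun j => (a j : ZMod p)) ∈ R)
      (f := fun (a : Fin s → ℤ) j => (a j : ZMod p)) (fun a ha => (Finset.mem_filter.1 ha).2), Nat.cast_sum, Finset.sum_div]
    refine Finset.sum_congr rfl fun r hr => ?_
    rw [Finset.prod_div_distrib, Finset.prod_const, Finset.card_univ, Fintype.card_fin,
      ← Nat.cast_prod, ← Fintype.card_piFinset]
    congr 3
    ext a
    simp only [Finset.mem_filter, nonzeroBox, Fintype.mem_piFinset, funext_iff, forall_and]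
    constructor
    · rintro ⟨⟨h1, -⟩, h2⟩; exact ⟨h1, h2⟩
    · rintro ⟨h1, h2⟩; exact ⟨⟨h1, by rwa [funext h2]⟩, h2⟩
  simp_rw [hcard]
  have h := tendsto_finsetSum R fun r _ => tendsto_finsetProd (Finset.univ : Finset (Fin s))
    fun j _ => tendsto_card_nonzeroInterval_residue (r j)
  refine h.trans_eq (congrArg nhds ?_)
  simp [div_eq_mul_inv]

lemma tendsto_of_eq_add_mul_dilate {f e : ℝ → ℝ} {K c q d : ℝ} (hd : 0 < d) (hq0 : 0 ≤ q)
    (hq1 : q < 1) (hf : ∀ A, 0 < A → |f A| ≤ K) (he : Tendsto e atTop (nhds c))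
    (hrec : ∀ A, 0 < A → f A = e A + q * f (A / d)) :
    Tendsto f atTop (nhds (c / (1 - q))) := by
  have hq : 0 < 1 - q := by linarith
  set L := c / (1 - q) with hL
  have hcL : c = L - q * L := by rw [hL]; field_simp
  have hK0 : 0 ≤ K := (abs_nonneg _).trans (hf 1 one_pos)
  have hdiv : Tendsto (fun A : ℝ => A / d) atTop atTop := tendsto_id.atTop_div_const hd
  rw [Metric.tendsto_nhds]
  intro ε hε
  have hstep (n : ℕ) : ∀ᶠ A in atTop, |f A - L| ≤ (K + |L|) * q ^ n + ε / 2 := by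
    induction n with
    | zero =>
      filter_upwards [eventually_gt_atTop 0] with A hA
      have := hf A hA
      have := abs_sub (f A) L
      rw [pow_zero, mul_one]
      linarith
    | succ n ih =>
      have he' := Metric.tendsto_nhds.1 he ((1 - q) * (ε / 2)) (by positivity)
      filter_upwards [hdiv.eventually ih, he', eventually_gt_atTop 0] with A h1 h2 hA
      rw [Real.dist_eq] at h2
      have h3 : f A - L = (e A - c) + q * (f (A / d) - L) := by
        rw [hrec A hA]; linear_combination hcL
      calc |f A - L| ≤ |e A - c| + |q * (f (A / d) - L)| := by rw [h3]; exact abs_add_le _ _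
        _ = |e A - c| + q * |f (A / d) - L| := by rw [abs_mul, abs_of_nonneg hq0]
        _ ≤ (1 - q) * (ε / 2) + q * ((K + |L|) * q ^ n + ε / 2) := by gcongr
        _ = _ := by ring
  have hpow : Tendsto (fun n : ℕ => (K + |L|) * q ^ n) atTop (nhds 0) := by
    simpa using (tendsto_pow_atTop_nhds_zero_of_lt_one hq0 hq1).const_mul (K + |L|)
  obtain ⟨n, hn⟩ := (hpow.eventually (gt_mem_nhds (half_pos hε))).exists
  filter_upwards [hstep n] with A hA
  rw [Real.dist_eq]
  linarith

lemma card_insoluble_nonzeroBox_eq {k p : ℕ} [Fact p.Prime] (hkp : ¬ p ∣ k) (s : ℕ) (A : ℝ) :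
    ((nonzeroBox s A).filter fun a => ¬ solZpUnit k p a).card =
      ((nonzeroBox s A).filter fun a =>
        (fun j => (a j : ZMod p)) ∈ insolubleResidues k s p).card +
      ((nonzeroBox s (A / p)).filter fun a => ¬ solZpUnit k p a).card := by
  have hp0 : 0 < p := (Fact.out : p.Prime).pos
  rw [← Finset.card_filter_add_card_filter_not
    (s := (nonzeroBox s A).filter fun a => ¬ solZpUnit k p a)
    (fun a => (fun j => (a j : ZMod p)) ≠ 0), Finset.filter_filter, Finset.filter_filter]
  congr 1
  · congr 1
    refine Finset.filter_congr fun a _ => ?_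
    simp only [insolubleResidues, Finset.mem_filter, Finset.mem_univ, true_and]
    constructor
    · rintro ⟨h1, h2⟩
      exact ⟨h2, fun h => h1 (h.solZpUnit hkp h2)⟩
    · rintro ⟨h1, h2⟩
      exact ⟨fun h => h2 h.solubleModUnits, h1⟩
  · symm
    refine Finset.card_bij (fun a _ j => (p : ℤ) * a j) ?_ ?_ ?_
    · intro a ha
      rw [Finset.mem_filter, mem_nonzeroBox] at ha ⊢
      refine ⟨fun j => ⟨mul_ne_zero (by lia) (ha.1 j).1, ?_⟩, ?_, ?_⟩
      · have := (ha.1 j).2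
        rw [Nat.floor_div_natCast, Nat.le_div_iff_mul_le hp0] at this
        rwa [Int.natAbs_mul, Int.natAbs_natCast, mul_comm]
      · rw [solZpUnit_mul_prime_iff]; exact ha.2
      · rw [not_not]; ext j; simp
    · intro a _ b _ h
      ext j
      exact mul_left_cancel₀ (by lia : (p : ℤ) ≠ 0) (congrFun h j)
    · intro b hb
      rw [Finset.mem_filter, mem_nonzeroBox, not_not] at hb
      obtain ⟨hb1, hb2, hb3⟩ := hb
      choose a ha using fun j => (ZMod.intCast_zmod_eq_zero_iff_dvd (b j) p).1 (congrFun hb3 j)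
      obtain rfl : b = fun j => (p : ℤ) * a j := funext ha
      refine ⟨a, ?_, rfl⟩
      rw [Finset.mem_filter, mem_nonzeroBox]
      refine ⟨fun j => ⟨right_ne_zero_of_mul (hb1 j).1, ?_⟩, ?_⟩
      · have := (hb1 j).2
        rw [Int.natAbs_mul, Int.natAbs_natCast] at this
        rwa [Nat.floor_div_natCast, Nat.le_div_iff_mul_le hp0, mul_comm]
      · rwa [solZpUnit_mul_prime_iff] at hb2

lemma tendsto_insoluble_density {k p : ℕ} [Fact p.Prime] (hkp : ¬ p ∣ k) {s : ℕ} (hs : s ≠ 0) :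
    Tendsto (fun A : ℝ =>
      (((nonzeroBox s A).filter fun a => ¬ solZpUnit k p a).card : ℝ) / (2 * A) ^ s)
      atTop (nhds ((insolubleResidues k s p).card / (p : ℝ) ^ s / (1 - 1 / (p : ℝ) ^ s))) := by
  have hp1 : (1 : ℝ) < p := by exact_mod_cast (Fact.out : p.Prime).one_lt
  have hp0 : (0 : ℝ) < p := by linarith
  refine tendsto_of_eq_add_mul_dilate (K := 1) (d := p) hp0 (by positivity) ?_ ?_
    (tendsto_card_nonzeroBox_residues (insolubleResidues k s p)) ?_
  · rw [div_lt_one (by positivity)]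
    exact one_lt_pow₀ hp1 hs
  · intro A hA
    rw [abs_of_nonneg (by positivity), div_le_one (by positivity)]
    calc (((nonzeroBox s A).filter fun a => ¬ solZpUnit k p a).card : ℝ)
        ≤ ((nonzeroBox s A).card : ℝ) := by exact_mod_cast Finset.card_filter_le _ _
      _ = (2 * (⌊A⌋₊ : ℝ)) ^ s := by rw [card_nonzeroBox]; push_cast; rfl
      _ ≤ (2 * A) ^ s := by gcongr; exact Nat.floor_le hA.le
  · intro A hA
    rw [card_insoluble_nonzeroBox_eq hkp, Nat.cast_add, add_div]
    congr 1
    rw [show 2 * (A / p) = 2 * A / p by ring, div_pow]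
    field_simp

end Density

theorem stmt6 (k s : ℕ) (hk : 2 ≤ k) (hs : 4 ≤ s) :
    ∃ P₀ : ℕ, ∀ p : ℕ, ∀ hp : p.Prime, P₀ ≤ p →
      Tendsto (fun A : ℝ =>
          ({a : Fin s → ℤ | (∀ j, a j ≠ 0) ∧ hgt a ≤ A ∧
              @solZpUnit k s p ⟨hp⟩ a}.ncard : ℝ) / (2 * A) ^ s)
        atTop
        (nhds (1 - (1 - 1 / (p : ℝ) ^ s)⁻¹ *
          ((s : ℝ) * (1 - 1 / (p : ℝ)) * (1 / (p : ℝ) ^ (s - 1)) +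
            ((s : ℝ) * ((s : ℝ) - 1) / 2) * (1 - 1 / (p : ℝ)) ^ 2 *
              (1 - 1 / (Nat.gcd (p - 1) k : ℝ)) * (1 / (p : ℝ) ^ (s - 2))))) := by
  refine ⟨8 * k ^ 6 + 2, fun p hp hP => ?_⟩
  have : Fact p.Prime := ⟨hp⟩
  have hk0 : 0 < k := by lia
  have hkp : ¬ p ∣ k := by
    intro h
    have h1 := Nat.le_of_dvd hk0 h
    have h2 : k ≤ k ^ 6 := Nat.le_self_pow (by norm_num) k
    lia
  have hp0 : (p : ℝ) ≠ 0 := Nat.cast_ne_zero.2 hp.ne_zero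
  have hbox : Tendsto (fun A : ℝ => ((⌊A⌋₊ : ℝ) / A) ^ s) atTop (nhds 1) := by
    simpa using (tendsto_nat_floor_div_atTop (R := ℝ)).pow s
  have hlim := hbox.sub (tendsto_insoluble_density hkp (by lia : s ≠ 0))
  rw [card_insolubleResidues hk0 hP] at hlim
  refine Tendsto.congr' ?_ (hlim.trans_eq (congrArg nhds ?_))
  · filter_upwards [eventually_gt_atTop 0] with A hA
    have hset : {a : Fin s → ℤ | (∀ j, a j ≠ 0) ∧ hgt a ≤ A ∧ solZpUnit k p a} =
        ((nonzeroBox s A).filter fun a => solZpUnit k p a : Finset (Fin s → ℤ)) := by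
      ext a
      simp [mem_nonzeroBox_iff_hgt hA.le, and_assoc]
    have hadd := congrArg (Nat.cast (R := ℝ)) (Finset.card_filter_add_card_filter_not
      (s := nonzeroBox s A) (fun a => solZpUnit k p a))
    rw [card_nonzeroBox] at hadd
    push_cast at hadd
    rw [hset, Set.ncard_coe_finset, eq_sub_of_add_eq hadd, sub_div, mul_pow, mul_pow,
      mul_div_mul_left _ _ (by positivity), div_pow]
  · obtain ⟨t, rfl⟩ : ∃ t, s = t + 2 := ⟨s - 2, by lia⟩
    rw [show t + 2 - 1 = t + 1 by lia, show t + 2 - 2 = t by lia, div_eq_inv_mul _ (1 - _)]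
    congr 2
    generalize (1 - 1 / (Nat.gcd (p - 1) k : ℝ)) = g
    field_simp
    ring
end
end

section
/- Let (a,b,c) be a primitive Pythagorean triple (positive integers with a² + b² = c² and gcd(a,b,c) = 1) with b even, and let r be an integer such that: r > 1 and r is not prime; every prime p dividing r satisfies p ≡ 1 (mod 4); and gcd(r,a) = gcd(r,b) = 1. Then: (i) the equation a²x² + b²y² − c²r²z² = 0 has a solution with x, y, z positive real numbers and, for every prime p, a solution with x, y, z all p-adic units; (ii) there is a constant C(a,b,c), depending only on a, b, c, such that any integers x, y, z with a²x² + b²y² − c²r²z² = 0 in which each of x and y is either 1 or a prime satisfies z ≤ C(a,b,c)/r. In particular, for r > C(a,b,c) the equation has no solution with x, y, z all prime. -/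
open scoped BigOperators Classical

noncomputable section

/-- In a Pythagorean relation `(a x)² + (b y)² = W²` with `a`, `b` coprime, `b` even and `x ≠ y`
prime, at least one of `x`, `y` is small in terms of `a` and `b`. -/
lemma prime_le_of_sq_add_sq {a b x y W : ℕ} (hb : 0 < b)
    (hab : Nat.Coprime a b) (hbeven : Even b) (hx : x.Prime) (hy : y.Prime) (hxy : x ≠ y)
    (h : a ^ 2 * x ^ 2 + b ^ 2 * y ^ 2 = W ^ 2) : x ≤ 2 * b + a ∨ y ≤ a := by
  by_contra! hlarge
  obtain ⟨hxl, hyl⟩ := hlarge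
  have ha : 0 < a := by
    rcases Nat.eq_zero_or_pos a with rfl | h0
    · rw [Nat.coprime_zero_left] at hab
      subst hab
      simp at hbeven
    · exact h0
  have hle : b * y ≤ W := by
    have h1 : (b * y) ^ 2 ≤ W ^ 2 := by rw [mul_pow]; omega
    exact (Nat.pow_le_pow_iff_left two_ne_zero).1 h1
  obtain ⟨U, rfl⟩ := Nat.exists_eq_add_of_le hle
  have hprod : U * (U + 2 * b * y) = (a * x) ^ 2 := by nlinarith
  have hcop : Nat.Coprime U (U + 2 * b * y) := by
    refine Nat.Coprime.symm (Nat.coprime_of_dvd fun q hq hqV hqU => ?_)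
    have hqax : q ∣ a * x := hq.dvd_of_dvd_pow (hprod ▸ hqU.mul_right _)
    have hqby : q ∣ 2 * b * y := (Nat.dvd_add_right hqU).1 hqV
    have hqb : q ∣ b ∨ q = y := by
      rcases hq.dvd_mul.1 hqby with h2 | h2
      · rcases hq.dvd_mul.1 h2 with h3 | h3
        · exact Or.inl (h3.trans hbeven.two_dvd)
        · exact Or.inl h3
      · exact Or.inr ((Nat.prime_dvd_prime_iff_eq hq hy).1 h2)
    rcases hq.dvd_mul.1 hqax with h1 | h1
    · rcases hqb with h2 | rfl
      · exact hq.one_lt.ne' (Nat.eq_one_of_dvd_coprimes hab h1 h2)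
      · exact absurd (Nat.le_of_dvd ha h1) (by omega)
    · obtain rfl := (Nat.prime_dvd_prime_iff_eq hq hx).1 h1
      rcases hqb with h2 | rfl
      · have := Nat.le_of_dvd hb h2
        omega
      · exact hxy rfl
  obtain ⟨s, hs⟩ := exists_eq_pow_of_mul_eq_pow (Nat.isUnit_iff.2 hcop) hprod
  obtain ⟨t, ht⟩ := exists_eq_pow_of_mul_eq_pow (Nat.isUnit_iff.2 hcop.symm)
    ((mul_comm _ _).trans hprod)
  have hst : s * t = a * x := by
    rw [ht, hs, ← mul_pow] at hprod
    exact Nat.pow_left_injective two_ne_zero hprod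
  have hlt : s < t := by
    have h1 : s ^ 2 < t ^ 2 := by
      rw [← ht, ← hs]
      have := Nat.mul_pos hb hy.pos
      nlinarith
    exact lt_of_pow_lt_pow_left' 2 h1
  obtain ⟨d, rfl⟩ := Nat.exists_eq_add_of_lt hlt
  have hfac : (d + 1) * (2 * s + d + 1) = 2 * b * y := by nlinarith
  have hd : d + 1 ≤ 2 * b := by
    rcases hy.dvd_mul.1 (Dvd.intro_left _ hfac.symm) with ⟨e, he⟩ | ⟨e, he⟩
    · have h1 : e * (2 * s + d + 1) = 2 * b := by
        apply Nat.eq_of_mul_eq_mul_right hy.pos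
        rw [← hfac, he]; ring
      have : 0 < e := Nat.pos_of_ne_zero (by rintro rfl; simp at he)
      nlinarith
    · have h1 : e * (d + 1) = 2 * b := by
        apply Nat.eq_of_mul_eq_mul_right hy.pos
        rw [← hfac, he]; ring
      have : 0 < e := Nat.pos_of_ne_zero (by rintro rfl; simp at he)
      nlinarith
  rcases hx.dvd_mul.1 (Dvd.intro_left _ hst.symm) with ⟨e, he⟩ | ⟨e, he⟩
  · have h1 : e * (s + d + 1) = a := by
      apply Nat.eq_of_mul_eq_mul_right hx.pos
      rw [← hst, he]; ring
    have h0 : 0 < e := Nat.pos_of_ne_zero fun h0 => by simp [h0] at h1; omega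
    have h2 := Nat.le_mul_of_pos_left (s + d + 1) h0
    have h3 := Nat.le_mul_of_pos_right x h0
    omega
  · have h1 : e * s = a := by
      apply Nat.eq_of_mul_eq_mul_right hx.pos
      rw [← hst, he]; ring
    have h0 : 0 < e := Nat.pos_of_ne_zero fun h0 => by simp [h0] at h1; omega
    have h2 := Nat.le_mul_of_pos_left s h0
    have h3 := Nat.le_mul_of_pos_right x h0
    omega

/-- A square that exceeds another one by `n > 0` is the square of a number at most `n`. -/
lemma le_of_add_sq_eq_sq {n m W : ℕ} (hn : 0 < n) (h : n + m ^ 2 = W ^ 2) : W ≤ n := by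
  have hlt : m < W := lt_of_pow_lt_pow_left' 2 (by omega : m ^ 2 < W ^ 2)
  nlinarith

/-- Solubility of `a²x² + b²y² = c²r²z²` in `p`-adic units. -/
lemma exists_padicInt_units {a b c r p : ℕ} [Fact p.Prime] (hpyth : a ^ 2 + b ^ 2 = c ^ 2)
    (hr : p ∣ r → p % 4 = 1) (hra : Nat.Coprime r a) (hrb : Nat.Coprime r b) :
    ∃ x y z : ℤ_[p], IsUnit x ∧ IsUnit y ∧ IsUnit z ∧
      (a : ℤ_[p]) ^ 2 * x ^ 2 + (b : ℤ_[p]) ^ 2 * y ^ 2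
        - (c : ℤ_[p]) ^ 2 * (r : ℤ_[p]) ^ 2 * z ^ 2 = 0 := by
  have hp : p.Prime := Fact.out
  have hunit : ∀ n : ℕ, ¬ p ∣ n → IsUnit (n : ℤ_[p]) := fun n hn => by
    rw [PadicInt.isUnit_iff]
    refine le_antisymm (PadicInt.norm_le_one _) (not_lt.1 fun hlt => hn ?_)
    have := (PadicInt.norm_int_lt_one_iff_dvd (p := p) (n : ℤ)).1 (by exact_mod_cast hlt)
    exact_mod_cast this
  have hpyth' : (a : ℤ_[p]) ^ 2 + (b : ℤ_[p]) ^ 2 = (c : ℤ_[p]) ^ 2 := by exact_mod_cast hpyth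
  by_cases hpr : p ∣ r
  · have hp4 := hr hpr
    have hau : IsUnit (a : ℤ_[p]) := hunit a fun h =>
      hp.one_lt.ne' (Nat.eq_one_of_dvd_coprimes hra hpr h)
    have hbu : IsUnit (b : ℤ_[p]) := hunit b fun h =>
      hp.one_lt.ne' (Nat.eq_one_of_dvd_coprimes hrb hpr h)
    have h2u : IsUnit (2 : ℤ_[p]) := by
      have := hunit 2 fun h => by
        have := (Nat.prime_dvd_prime_iff_eq hp Nat.prime_two).1 h
        omega
      exact_mod_cast this
    obtain ⟨i, hi⟩ : ∃ i : ℤ_[p], i ^ 2 = -1 := by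
      obtain ⟨j, hj⟩ := ZMod.exists_sq_eq_neg_one_iff (p := p) |>.2 (by omega)
      have hjd : (p : ℤ) ∣ (j.val : ℤ) ^ 2 + 1 := by
        rw [← ZMod.intCast_zmod_eq_zero_iff_dvd]
        push_cast
        rw [ZMod.natCast_zmod_val, sq, ← hj]; ring
      have hju : ¬ p ∣ j.val := fun h => by
        have h1 : (p : ℤ) ∣ 1 := by
          have h2 : (p : ℤ) ∣ (j.val : ℤ) ^ 2 :=
            Dvd.dvd.pow (Int.natCast_dvd_natCast.2 h) two_ne_zero
          exact (Int.dvd_add_right h2).1 hjd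
        exact hp.one_lt.ne' (by exact_mod_cast Int.eq_one_of_dvd_one (by positivity) h1)
      have hder : ‖(2 : ℤ_[p]) * (j.val : ℤ_[p])‖ = 1 :=
        PadicInt.isUnit_iff.1 (h2u.mul (hunit _ hju))
      have hnorm : ‖((j.val : ℤ_[p])) ^ 2 + 1‖ < 1 := by
        have := (PadicInt.norm_int_lt_one_iff_dvd (p := p) _).2 hjd
        exact_mod_cast this
      obtain ⟨i, hi, -⟩ := hensels_lemma (p := p) (R := ℤ_[p])
        (F := (Polynomial.X ^ 2 + 1 : Polynomial ℤ_[p])) (a := (j.val : ℤ_[p]))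
        (by
          have hF : Polynomial.aeval (j.val : ℤ_[p]) (Polynomial.X ^ 2 + 1 : Polynomial ℤ_[p]) =
              (j.val : ℤ_[p]) ^ 2 + 1 := by simp
          have hF' : Polynomial.aeval (j.val : ℤ_[p])
              (Polynomial.derivative (Polynomial.X ^ 2 + 1 : Polynomial ℤ_[p])) =
              2 * (j.val : ℤ_[p]) := by simp [one_add_one_eq_two]
          rw [hF, hF', hder, one_pow]
          exact hnorm)
      refine ⟨i, ?_⟩
      have : i ^ 2 + 1 = 0 := by simpa using hi
      linear_combination this
    have hiu : IsUnit i := IsUnit.of_mul_eq_one (-i) (by linear_combination -hi)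
    have hmem : (c : ℤ_[p]) ^ 2 * (r : ℤ_[p]) ^ 2 ∈ IsLocalRing.maximalIdeal ℤ_[p] := by
      refine Ideal.mul_mem_left _ _ (Ideal.pow_mem_of_mem _ ?_ 2 two_pos)
      rw [IsLocalRing.mem_maximalIdeal, mem_nonunits_iff, PadicInt.isUnit_iff]
      have := (PadicInt.norm_int_lt_one_iff_dvd (p := p) (r : ℤ)).2 (by exact_mod_cast hpr)
      exact ne_of_lt (by exact_mod_cast this)
    set m := (c : ℤ_[p]) ^ 2 * (r : ℤ_[p]) ^ 2 with hm
    have hsub : IsUnit (1 - m) := IsLocalRing.isUnit_one_sub_self_of_mem_nonunits _ hmem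
    have hadd : IsUnit (1 + m) := by
      have := IsLocalRing.isUnit_one_sub_self_of_mem_nonunits (-m)
        ((IsLocalRing.maximalIdeal ℤ_[p]).neg_mem hmem)
      simpa using this
    obtain ⟨A, hA⟩ := (h2u.mul hau).exists_left_inv
    obtain ⟨B, hB⟩ := ((h2u.mul hbu).mul hiu).exists_left_inv
    refine ⟨A * (1 + m), B * (1 - m), 1, (IsUnit.of_mul_eq_one _ hA).mul hadd,
      (IsUnit.of_mul_eq_one _ hB).mul hsub, isUnit_one, ?_⟩
    have hA2 : 4 * ((a : ℤ_[p]) ^ 2 * A ^ 2) = 1 := by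
      linear_combination (A * (2 * a) + 1) * hA
    have hB2 : 4 * ((b : ℤ_[p]) ^ 2 * B ^ 2) = -1 := by
      linear_combination (-(B * (2 * b * i) + 1)) * hB + 4 * (b : ℤ_[p]) ^ 2 * B ^ 2 * hi
    apply (mul_eq_zero.1 _).resolve_left (h2u.mul h2u).ne_zero
    linear_combination (1 + m) ^ 2 * hA2 + (1 - m) ^ 2 * hB2
  · exact ⟨r, r, 1, hunit r hpr, hunit r hpr, isUnit_one,
      by linear_combination (r : ℤ_[p]) ^ 2 * hpyth'⟩

theorem stmt10 (a b c : ℕ) (ha : 0 < a) (hb : 0 < b) (hc : 0 < c)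
    (hpyth : a ^ 2 + b ^ 2 = c ^ 2) (hprim : Nat.gcd a (Nat.gcd b c) = 1)
    (hbeven : Even b) :
    ∃ C : ℝ, 0 < C ∧ ∀ r : ℕ, 1 < r → ¬ r.Prime →
      (∀ p : ℕ, p.Prime → p ∣ r → p % 4 = 1) →
      Nat.Coprime r a → Nat.Coprime r b →
      -- (i) solubility in positive reals and in p-adic units for every prime p
      ((∃ x y z : ℝ, 0 < x ∧ 0 < y ∧ 0 < z ∧
          (a : ℝ) ^ 2 * x ^ 2 + (b : ℝ) ^ 2 * y ^ 2
            - (c : ℝ) ^ 2 * (r : ℝ) ^ 2 * z ^ 2 = 0) ∧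
        (∀ (p : ℕ) [Fact p.Prime], ∃ x y z : ℤ_[p],
          IsUnit x ∧ IsUnit y ∧ IsUnit z ∧
          (a : ℤ_[p]) ^ 2 * x ^ 2 + (b : ℤ_[p]) ^ 2 * y ^ 2
            - (c : ℤ_[p]) ^ 2 * (r : ℤ_[p]) ^ 2 * z ^ 2 = 0)) ∧
      -- (ii) any solution with x, y each 1 or prime has z ≤ C / r
      (∀ (x y : ℕ) (z : ℤ), (x = 1 ∨ x.Prime) → (y = 1 ∨ y.Prime) →
        (a : ℤ) ^ 2 * (x : ℤ) ^ 2 + (b : ℤ) ^ 2 * (y : ℤ) ^ 2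
            - (c : ℤ) ^ 2 * (r : ℤ) ^ 2 * z ^ 2 = 0 →
        (z : ℝ) ≤ C / (r : ℝ)) ∧
      -- hence no solutions in the primes when r > C
      (C < (r : ℝ) → ¬ ∃ x y z : ℕ, x.Prime ∧ y.Prime ∧ z.Prime ∧
        (a : ℤ) ^ 2 * (x : ℤ) ^ 2 + (b : ℤ) ^ 2 * (y : ℤ) ^ 2
          - (c : ℤ) ^ 2 * (r : ℤ) ^ 2 * (z : ℤ) ^ 2 = 0) := by
  have hab : Nat.Coprime a b := by
    refine Nat.coprime_of_dvd fun q hq hqa hqb => ?_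
    have hqc : q ∣ c := hq.dvd_of_dvd_pow (hpyth ▸
      dvd_add (hqa.trans (dvd_pow_self a two_ne_zero)) (hqb.trans (dvd_pow_self b two_ne_zero)))
    exact hq.one_lt.ne' (Nat.dvd_one.1 (hprim ▸ Nat.dvd_gcd hqa (Nat.dvd_gcd hqb hqc)))
  obtain ⟨C, hC⟩ : ∃ C : ℕ, C = a ^ 2 * (2 * b + a) ^ 2 + b ^ 2 * a ^ 2 := ⟨_, rfl⟩
  have hCpos : 0 < C := by rw [hC]; positivity
  refine ⟨C, by exact_mod_cast hCpos, fun r hr1 hrp hrmod hra hrb => ?_⟩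
  have hr0 : (0 : ℝ) < r := by exact_mod_cast (by omega : 0 < r)
  have hbound : ∀ (x y : ℕ) (z : ℤ), (x = 1 ∨ x.Prime) → (y = 1 ∨ y.Prime) →
      (a : ℤ) ^ 2 * (x : ℤ) ^ 2 + (b : ℤ) ^ 2 * (y : ℤ) ^ 2
        - (c : ℤ) ^ 2 * (r : ℤ) ^ 2 * z ^ 2 = 0 → (z : ℝ) ≤ C / (r : ℝ) := by
    intro x y z hx hy heq
    have hx0 : 0 < x := by rcases hx with rfl | h; exacts [one_pos, h.pos]
    have hy0 : 0 < y := by rcases hy with rfl | h; exacts [one_pos, h.pos]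
    have hnat : a ^ 2 * x ^ 2 + b ^ 2 * y ^ 2 = (c * r * z.natAbs) ^ 2 := by
      zify
      rw [mul_pow, sq_abs]
      linear_combination heq
    have hxy : x ≠ y := by
      rintro rfl
      have h1 : (c * x) ^ 2 = (c * (r * z.natAbs)) ^ 2 := by
        rw [← mul_assoc, ← hnat, ← add_mul, hpyth, mul_pow]
      have h2 : x = r * z.natAbs :=
        Nat.eq_of_mul_eq_mul_left hc (Nat.pow_left_injective two_ne_zero h1)
      have h3 : r ∣ x := Dvd.intro _ h2.symm
      rcases hx with rfl | hx
      · exact hr1.ne' (Nat.dvd_one.1 h3)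
      · rcases (Nat.dvd_prime hx).1 h3 with h4 | rfl
        · exact hr1.ne' h4
        · exact hrp hx
    have hsmall : x ≤ 2 * b + a ∨ y ≤ a := by
      rcases hx with rfl | hx
      · left; omega
      rcases hy with rfl | hy
      · right; omega
      exact prime_le_of_sq_add_sq hb hab hbeven hx hy hxy hnat
    have hW : c * r * z.natAbs ≤ C := by
      rw [hC]
      rcases hsmall with h | h
      · have h1 := le_of_add_sq_eq_sq (n := a ^ 2 * x ^ 2) (m := b * y) (by positivity)
          (by rw [← hnat]; ring)
        have h2 : a ^ 2 * x ^ 2 ≤ a ^ 2 * (2 * b + a) ^ 2 := by gcongr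
        omega
      · have h1 := le_of_add_sq_eq_sq (n := b ^ 2 * y ^ 2) (m := a * x) (by positivity)
          (by rw [← hnat]; ring)
        have h2 : b ^ 2 * y ^ 2 ≤ b ^ 2 * a ^ 2 := by gcongr
        omega
    rw [le_div_iff₀ hr0]
    have h1 : r * z.natAbs ≤ C := by nlinarith [Nat.zero_le (r * z.natAbs)]
    have h2 : z * (r : ℤ) ≤ C := by
      have h3 : (r : ℤ) * |z| ≤ C := by
        rw [← Int.natCast_natAbs]; exact_mod_cast h1
      nlinarith [le_abs_self z]
    exact_mod_cast h2
  refine ⟨⟨⟨r, r, 1, hr0, hr0, one_pos, ?_⟩, fun p hp =>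
    exists_padicInt_units hpyth (hrmod p hp.out) hra hrb⟩, hbound, ?_⟩
  · have h : (a : ℝ) ^ 2 + (b : ℝ) ^ 2 = (c : ℝ) ^ 2 := by exact_mod_cast hpyth
    linear_combination (r : ℝ) ^ 2 * h
  · rintro hCr ⟨x, y, z, hx, hy, hz, heq⟩
    have h1 := hbound x y z (Or.inr hx) (Or.inr hy) heq
    have h2 : (C : ℝ) / r < 1 := (div_lt_one hr0).2 hCr
    have h3 : (1 : ℝ) ≤ ((z : ℤ) : ℝ) := by exact_mod_cast hz.one_lt.le
    linarith
end
end

section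
/- Let a, b, c be positive integers with b even, let S be a finite nonempty set of positive integers with h = max S, and let P(S) = { m·l : m ∈ S, l = 1 or l prime }. Suppose x, y ∈ P(S) and z ∈ ℤ satisfy a²x² + b²y² = c²z² and gcd(ax, by, cz) = 1. Then x ≤ h²·a·(a+b), y ≤ h²·b·(a+b/2), and z ≤ (h²/c)·(a² + ab + b²/2). -/
open scoped BigOperators Classical

noncomputable section

/-- The smaller of two factors of `k * l`, with `l` prime or `1`, is at most `k`. -/
theorem le_of_mul_eq_mul_one_or_prime {u v k l : ℕ} (hk : 0 < k) (huv : u ≤ v)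
    (hl : l = 1 ∨ l.Prime) (h : u * v = k * l) : u ≤ k := by
  rcases hl with rfl | hl
  · nlinarith
  · rcases (hl.dvd_mul).1 (h ▸ dvd_mul_left l k) with ⟨w, rfl⟩ | ⟨w, rfl⟩
    · have hw : w * v = k := Nat.eq_of_mul_eq_mul_left hl.pos (by linarith)
      exact huv.trans (Nat.le_of_dvd hk ⟨w, by linarith⟩)
    · have hw : u * w = k := Nat.eq_of_mul_eq_mul_left hl.pos (by linarith)
      exact Nat.le_of_dvd hk ⟨w, hw.symm⟩

/-- A Pythagorean triple with even second leg, all three entries having no common factor, is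
`(s ^ 2 - t ^ 2, 2 * s * t, s ^ 2 + t ^ 2)`, written here with `s = t + d`. -/
theorem exists_parametrization_of_even_leg {u v : ℕ} {w : ℤ} (hu : 0 < u) (hv : 0 < v)
    (hev : Even v) (h : (u : ℤ) ^ 2 + (v : ℤ) ^ 2 = w ^ 2)
    (hgcd : Int.gcd u (Int.gcd v w) = 1) :
    ∃ t d : ℕ, u = d * (d + 2 * t) ∧ v = 2 * (t * (t + d)) ∧
      w ≤ ((t : ℤ) + d) ^ 2 + (t : ℤ) ^ 2 := by
  have hcop : Int.gcd u v = 1 := by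
    have h1 : ((Int.gcd u v : ℕ) : ℤ) ∣ u := Int.gcd_dvd_left ..
    have h2 : ((Int.gcd u v : ℕ) : ℤ) ∣ v := Int.gcd_dvd_right ..
    have h3 : ((Int.gcd u v : ℕ) : ℤ) ∣ w := by
      rw [← Int.pow_dvd_pow_iff two_ne_zero, ← h]
      exact dvd_add (pow_dvd_pow_of_dvd h1 2) (pow_dvd_pow_of_dvd h2 2)
    have h4 := Int.dvd_coe_gcd h1 (Int.dvd_coe_gcd h2 h3)
    rw [hgcd] at h4
    exact Nat.dvd_one.1 (by exact_mod_cast h4)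
  have hodd : (u : ℤ) % 2 = 1 := by
    by_contra hne
    have h1 : (2 : ℤ) ∣ u := by omega
    have h2 : (2 : ℤ) ∣ v := by exact_mod_cast hev.two_dvd
    have h3 := Int.dvd_coe_gcd h1 h2
    rw [hcop] at h3
    norm_num at h3
  have htriple : PythagoreanTriple (u : ℤ) v |w| := by
    unfold PythagoreanTriple
    rw [abs_mul_abs_self]
    linarith
  have hw : 0 < |w| := by
    rw [abs_pos]
    rintro rfl
    have : (0 : ℤ) < u := by exact_mod_cast hu
    nlinarith [sq_nonneg (v : ℤ)]
  obtain ⟨s, t, hus, hvs, hws, -, -, hs⟩ :=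
    htriple.coprime_classification' hcop hodd hw
  have hu' : (0 : ℤ) < u := by exact_mod_cast hu
  have hv' : (0 : ℤ) < v := by exact_mod_cast hv
  have ht : 0 < t := by
    by_contra! ht
    nlinarith [mul_nonneg hs (neg_nonneg.2 ht)]
  have hts : t < s := by
    by_contra! hts
    nlinarith
  obtain ⟨d, rfl⟩ := Int.le.dest hts.le
  lift t to ℕ using ht.le
  refine ⟨t, d, ?_, ?_, (le_abs_self w).trans hws.le⟩
  · zify
    linarith
  · zify
    linarith

theorem stmt12 (a b c : ℕ) (ha : 0 < a) (hb : 0 < b) (hc : 0 < c)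
    (hbeven : Even b)
    (S : Finset ℕ) (hS : S.Nonempty) (hSpos : ∀ m ∈ S, 0 < m)
    (x y : ℕ) (z : ℤ)
    (hx : ∃ m ∈ S, ∃ l : ℕ, (l = 1 ∨ l.Prime) ∧ x = m * l)
    (hy : ∃ m ∈ S, ∃ l : ℕ, (l = 1 ∨ l.Prime) ∧ y = m * l)
    (heq : (a : ℤ) ^ 2 * (x : ℤ) ^ 2 + (b : ℤ) ^ 2 * (y : ℤ) ^ 2
      = (c : ℤ) ^ 2 * z ^ 2)
    (hgcd : Int.gcd ((a : ℤ) * (x : ℤ)) (Int.gcd ((b : ℤ) * (y : ℤ)) ((c : ℤ) * z)) = 1) :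
    (x : ℝ) ≤ (S.max' hS : ℝ) ^ 2 * (a : ℝ) * ((a : ℝ) + (b : ℝ)) ∧
    (y : ℝ) ≤ (S.max' hS : ℝ) ^ 2 * (b : ℝ) * ((a : ℝ) + (b : ℝ) / 2) ∧
    (z : ℝ) ≤ ((S.max' hS : ℝ) ^ 2 / (c : ℝ)) *
      ((a : ℝ) ^ 2 + (a : ℝ) * (b : ℝ) + (b : ℝ) ^ 2 / 2) := by
  obtain ⟨m, hm, p, hp, rfl⟩ := hx
  obtain ⟨n, hn, q, hq, rfl⟩ := hy
  have hpos : ∀ l : ℕ, l = 1 ∨ l.Prime → 0 < l := by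
    rintro l (rfl | hl)
    · exact one_pos
    · exact hl.pos
  have hm0 := hSpos m hm
  have hn0 := hSpos n hn
  have hp0 := hpos p hp
  have hq0 := hpos q hq
  obtain ⟨t, d, hu, hv, hw⟩ := exists_parametrization_of_even_leg
    (u := a * (m * p)) (v := b * (n * q)) (w := (c : ℤ) * z) (by positivity) (by positivity)
    (hbeven.mul_right _) (by push_cast at heq ⊢; linarith) (by push_cast at hgcd ⊢; exact hgcd)
  obtain ⟨e, rfl⟩ := hbeven
  have he : 0 < e := by omega
  have hd : d ≤ a * m := le_of_mul_eq_mul_one_or_prime (v := d + 2 * t) (by positivity)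
    (by omega) hp (by linarith)
  have ht : t ≤ e * n := le_of_mul_eq_mul_one_or_prime (v := t + d) (by positivity)
    (by omega) hq (by linarith)
  have hmh : m ≤ S.max' hS := S.le_max' m hm
  have hnh : n ≤ S.max' hS := S.le_max' n hn
  generalize S.max' hS = h at hmh hnh ⊢
  have hdR : (d : ℝ) ≤ a * h := by exact_mod_cast hd.trans (Nat.mul_le_mul_left a hmh)
  have htR : (t : ℝ) ≤ e * h := by exact_mod_cast ht.trans (Nat.mul_le_mul_left e hnh)
  have huR : (a : ℝ) * (m * p : ℕ) = d * (d + 2 * t) := by exact_mod_cast hu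
  have hvR : (e : ℝ) * (n * q : ℕ) = t * (t + d) := by
    have : e * (n * q) = t * (t + d) := by linarith
    exact_mod_cast this
  have hwR : (c : ℝ) * z ≤ ((t : ℝ) + d) ^ 2 + (t : ℝ) ^ 2 := by exact_mod_cast hw
  have haR : (1 : ℝ) ≤ a := by exact_mod_cast ha
  have heR : (1 : ℝ) ≤ e := by exact_mod_cast he
  have hcR : (0 : ℝ) < c := by exact_mod_cast hc
  push_cast [Nat.cast_add] at *
  refine ⟨?_, ?_, ?_⟩
  · have hX : (m * p : ℝ) ≤ h ^ 2 * (a + (e + e)) := by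
      refine le_of_mul_le_mul_left (a := (a : ℝ)) ?_ (by positivity)
      calc (a : ℝ) * (m * p) = d * (d + 2 * t) := huR
        _ ≤ (a * h) * (a * h + 2 * (e * h)) := by gcongr
        _ = a * (h ^ 2 * (a + (e + e))) := by ring
    calc (m * p : ℝ) ≤ h ^ 2 * (a + (e + e)) := hX
      _ = h ^ 2 * 1 * (a + (e + e)) := by ring
      _ ≤ h ^ 2 * a * (a + (e + e)) := by gcongr
  · have hY : (n * q : ℝ) ≤ h ^ 2 * (a + e) := by
      refine le_of_mul_le_mul_left (a := (e : ℝ)) ?_ (by positivity)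
      calc (e : ℝ) * (n * q) = t * (t + d) := hvR
        _ ≤ (e * h) * (e * h + a * h) := by gcongr
        _ = e * (h ^ 2 * (a + e)) := by ring
    calc (n * q : ℝ) ≤ h ^ 2 * (a + e) := hY
      _ = h ^ 2 * 1 * (a + (e + e) / 2) := by ring
      _ ≤ h ^ 2 * (e + e) * (a + (e + e) / 2) := by
        gcongr
        linarith
  · rw [div_mul_eq_mul_div, le_div_iff₀ hcR]
    calc (z : ℝ) * c = c * z := mul_comm _ _
      _ ≤ ((t : ℝ) + d) ^ 2 + (t : ℝ) ^ 2 := hwR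
      _ ≤ (e * h + a * h) ^ 2 + (e * h) ^ 2 := by gcongr
      _ = h ^ 2 * (a ^ 2 + a * (e + e) + (e + e) ^ 2 / 2) := by ring
end
end

section
/- Let k ≥ 1 and let a = (a_1,…,a_s) be a tuple of nonzero integers. Then T_a is multiplicative: for all positive integers q_1, q_2 with gcd(q_1, q_2) = 1, T_a(q_1 q_2) = T_a(q_1)·T_a(q_2). -/
open scoped BigOperators Classical
open Filter MeasureTheory

noncomputable section

/-- `e(x) = e^{2πix}`. -/
def eC (x : ℝ) : ℂ := Complex.exp (2 * Real.pi * Complex.I * x)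

/-- `W(q,r) = Σ_{h=1,…,q, (h;q)=1} e_q(r h^k)`. -/
def Wsum (k q : ℕ) (r : ℤ) : ℂ :=
  ∑ h ∈ Finset.Icc 1 q,
    if Nat.gcd h q = 1 then eC (((r * (h : ℤ) ^ k : ℤ) : ℝ) / (q : ℝ)) else 0

/-- `T_a(q) = φ(q)^{-s} Σ_{r=1,…,q, (r;q)=1} ∏_j W(q, a_j r)`. -/
def Tsum (k : ℕ) {s : ℕ} (a : Fin s → ℤ) (q : ℕ) : ℂ :=
  ((Nat.totient q : ℂ))⁻¹ ^ s *
    ∑ r ∈ Finset.Icc 1 q,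
      if Nat.gcd r q = 1 then ∏ j, Wsum k q (a j * r) else 0

/-- Summation over the reduced residues `1 ≤ h ≤ q` is summation over the unit group of `ZMod q`. -/
theorem sum_Icc_coprime_eq_sum_units (q : ℕ) [NeZero q] (F : ZMod q → ℂ) :
    (∑ h ∈ Finset.Icc 1 q, if Nat.gcd h q = 1 then F (h : ZMod q) else 0) =
      ∑ u : (ZMod q)ˣ, F u := by
  rw [← Finset.sum_filter]
  refine Finset.sum_bij' (fun h _ => if hc : Nat.Coprime h q then ZMod.unitOfCoprime h hc else 1)
    (fun u _ => if (u : ZMod q).val = 0 then q else (u : ZMod q).val) ?_ ?_ ?_ ?_ ?_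
  · simp
  · intro u _
    have hu := ZMod.val_coe_unit_coprime u
    have hlt := ZMod.val_lt (u : ZMod q)
    simp only [Finset.mem_filter, Finset.mem_Icc]
    split_ifs with h0
    · rw [h0, Nat.coprime_zero_left] at hu
      simp [hu]
    · exact ⟨⟨by omega, hlt.le⟩, hu⟩
  · intro h hh
    simp only [Finset.mem_filter, Finset.mem_Icc] at hh
    obtain ⟨⟨h1, h2⟩, hc⟩ := hh
    rw [dif_pos hc, ZMod.coe_unitOfCoprime, ZMod.val_natCast]
    rcases h2.lt_or_eq with h2 | rfl
    · rw [Nat.mod_eq_of_lt h2, if_neg (by omega)]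
    · simp
  · intro u _
    have hu := ZMod.val_coe_unit_coprime u
    ext
    split_ifs with h0 hc
    · simp [(ZMod.val_eq_zero _).1 h0]
    · rw [h0, Nat.coprime_zero_left] at hu
      exact (hc (by simp [hu])).elim
    · simp
  · intro h hh
    simp only [Finset.mem_filter, Finset.mem_Icc] at hh
    rw [dif_pos hh.2, ZMod.coe_unitOfCoprime]

/-- The sum `Wsum` in terms of the standard additive character of `ZMod q`. -/
theorem Wsum_eq_sum_units (k q : ℕ) [NeZero q] (r : ℤ) :
    Wsum k q r = ∑ u : (ZMod q)ˣ, ZMod.stdAddChar ((r : ZMod q) * (u : ZMod q) ^ k) := by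
  rw [← sum_Icc_coprime_eq_sum_units q fun x => ZMod.stdAddChar ((r : ZMod q) * x ^ k), Wsum]
  refine Finset.sum_congr rfl fun h _ => if_congr Iff.rfl ?_ rfl
  have hcast : (r : ZMod q) * (h : ZMod q) ^ k = ((r * (h : ℤ) ^ k : ℤ) : ZMod q) := by
    push_cast; rfl
  rw [hcast, ZMod.stdAddChar_coe, eC]
  congr 1
  push_cast
  ring

/-- `Tsum` as a sum over the unit group of `ZMod q`. -/
theorem Tsum_eq_sum_units (k : ℕ) {s : ℕ} (a : Fin s → ℤ) (q : ℕ) [NeZero q] :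
    Tsum k a q = ((Nat.totient q : ℂ))⁻¹ ^ s * ∑ r : (ZMod q)ˣ, ∏ j,
      ∑ u : (ZMod q)ˣ, ZMod.stdAddChar ((a j : ZMod q) * (r : ZMod q) * (u : ZMod q) ^ k) := by
  rw [← sum_Icc_coprime_eq_sum_units q fun x => ∏ j,
      ∑ u : (ZMod q)ˣ, ZMod.stdAddChar ((a j : ZMod q) * x * (u : ZMod q) ^ k), Tsum]
  simp only [Wsum_eq_sum_units, Int.cast_mul, Int.cast_natCast]

/-- The unit group of `ZMod (m * n)` is the product of the unit groups, for coprime `m`, `n`. -/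
def unitsChineseRemainder {m n : ℕ} (h : Nat.Coprime m n) :
    (ZMod (m * n))ˣ ≃* (ZMod m)ˣ × (ZMod n)ˣ :=
  (Units.mapEquiv (ZMod.chineseRemainder h).toMulEquiv).trans MulEquiv.prodUnits

/-- Twisting by `m + n` splits the standard additive character modulo `m * n`. -/
theorem stdAddChar_add_mul {m n : ℕ} [NeZero m] [NeZero n] (h : Nat.Coprime m n)
    (x : ZMod (m * n)) :
    ZMod.stdAddChar (((m : ZMod (m * n)) + (n : ZMod (m * n))) * x) =
      ZMod.stdAddChar (ZMod.chineseRemainder h x).1 *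
        ZMod.stdAddChar (ZMod.chineseRemainder h x).2 := by
  obtain ⟨y, rfl⟩ := ZMod.intCast_surjective x
  have hcast : ((m : ZMod (m * n)) + (n : ZMod (m * n))) * (y : ZMod (m * n)) =
      (((m + n) * y : ℤ) : ZMod (m * n)) := by push_cast; rfl
  rw [hcast, map_intCast (ZMod.chineseRemainder h), Prod.fst_intCast, Prod.snd_intCast, ZMod.stdAddChar_coe,
    ZMod.stdAddChar_coe, ZMod.stdAddChar_coe, ← Complex.exp_add]
  have hm : (m : ℂ) ≠ 0 := NeZero.ne _
  have hn : (n : ℂ) ≠ 0 := NeZero.ne _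
  congr 1
  push_cast
  field_simp
  ring

/-- Multiplicativity of the complete sums over units, after the twist by `m + n`. -/
theorem sum_units_stdAddChar_add_mul {m n : ℕ} [NeZero m] [NeZero n] (h : Nat.Coprime m n)
    (k : ℕ) (x : ZMod (m * n)) :
    ∑ u : (ZMod (m * n))ˣ, ZMod.stdAddChar
        (((m : ZMod (m * n)) + (n : ZMod (m * n))) * x * (u : ZMod (m * n)) ^ k) =
      (∑ v : (ZMod m)ˣ, ZMod.stdAddChar ((ZMod.chineseRemainder h x).1 * (v : ZMod m) ^ k)) *
        ∑ w : (ZMod n)ˣ, ZMod.stdAddChar ((ZMod.chineseRemainder h x).2 * (w : ZMod n) ^ k) := by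
  rw [Finset.sum_mul_sum, ← Fintype.sum_prod_type']
  refine Fintype.sum_equiv (unitsChineseRemainder h).toEquiv _ _ fun u => ?_
  rw [mul_assoc, stdAddChar_add_mul h, map_mul, map_pow]
  rfl

theorem stmt17 (k s : ℕ) (hk : 1 ≤ k)
    (a : Fin s → ℤ) (ha : ∀ j, a j ≠ 0)
    (q₁ q₂ : ℕ) (hq₁ : 0 < q₁) (hq₂ : 0 < q₂) (hco : Nat.Coprime q₁ q₂) :
    Tsum k a (q₁ * q₂) = Tsum k a q₁ * Tsum k a q₂ := by
  have : NeZero q₁ := ⟨hq₁.ne'⟩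
  have : NeZero q₂ := ⟨hq₂.ne'⟩
  have hunit : Nat.Coprime (q₁ + q₂) (q₁ * q₂) := by
    apply Nat.Coprime.mul_right
    · simpa using hco.symm
    · simpa using hco
  simp only [Tsum_eq_sum_units]
  rw [Nat.totient_mul hco, Nat.cast_mul, mul_inv, mul_pow, mul_mul_mul_comm]
  congr 1
  rw [Finset.sum_mul_sum, ← Fintype.sum_prod_type',
    ← Equiv.sum_comp (Equiv.mulLeft (ZMod.unitOfCoprime _ hunit))]
  refine Fintype.sum_equiv (unitsChineseRemainder hco).toEquiv _ _ fun r => ?_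
  rw [← Finset.prod_mul_distrib]
  refine Finset.prod_congr rfl fun j _ => ?_
  have key := sum_units_stdAddChar_add_mul hco k ((a j : ZMod (q₁ * q₂)) * r)
  rw [map_mul, map_intCast] at key
  rw [Equiv.coe_mulLeft, Units.val_mul, ZMod.coe_unitOfCoprime, Nat.cast_add, mul_left_comm]
  exact key
end
end

section
/- Let k ≥ 2, s ≥ 5, let a = (a_1,…,a_s) be a tuple of nonzero integers, and let p be a prime. Set λ(p) equal to the p-adic valuation of gcd(a_1,…,a_s). Then the following are equivalent: (i) χ_p ≠ 0; (ii) the equation a_1 x_1^k + … + a_s x_s^k = 0 has a solution with all x_j p-adic units; (iii) the congruence a_1 x_1^k + … + a_s x_s^k ≡ 0 (mod p^{ξ(p)+λ(p)}) has a solution with every x_j coprime to p. Moreover, when these hold, χ_p ≥ p^{−ξ(p)(s−1)+λ(p)}. -/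
open scoped BigOperators Classical

noncomputable section

/-- `M_a(q)`: the number of tuples of units of `ℤ/qℤ` satisfying
`∑ a_j x_j^k ≡ 0 (mod q)`. -/
def Mcount (k : ℕ) {s : ℕ} (a : Fin s → ℤ) (q : ℕ) : ℕ :=
  Nat.card {x : Fin s → (ZMod q)ˣ | ∑ j, (a j : ZMod q) * ((x j : ZMod q)) ^ k = 0}

/-- `ξ(p) = ν(p) + 2` if `p = 2` and `ν(p) + 1` otherwise, where `p^{ν(p)} ∥ k`. -/
def xiExp (k p : ℕ) : ℕ :=
  if p = 2 then k.factorization p + 2 else k.factorization p + 1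

section PadicRoots

variable {p : ℕ} [hp : Fact p.Prime]

lemma PadicInt.exists_pow_eq_of_norm_lt {m : ℕ} {a c : ℤ_[p]} (ha : IsUnit a)
    (h : ‖a ^ m - c‖ < ‖(m : ℤ_[p])‖ ^ 2) :
    ∃ z : ℤ_[p], z ^ m = c ∧ ‖z - a‖ < ‖(m : ℤ_[p])‖ := by
  have hd : ‖(Polynomial.X ^ m - Polynomial.C c : Polynomial ℤ_[p]).derivative.aeval a‖
      = ‖(m : ℤ_[p])‖ := by
    simp [Polynomial.derivative_X_pow, PadicInt.isUnit_iff.1 ha]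
  obtain ⟨z, hz, hza, -⟩ := hensels_lemma (p := p) (R := ℤ_[p])
    (F := (Polynomial.X ^ m - Polynomial.C c : Polynomial ℤ_[p])) (a := a)
    (by rw [hd]; simpa using h)
  exact ⟨z, by simpa [sub_eq_zero] using hz, by rwa [hd] at hza⟩

lemma PadicInt.pow_dvd_iff_norm_le (x : ℤ_[p]) (n : ℕ) :
    (p : ℤ_[p]) ^ n ∣ x ↔ ‖x‖ ≤ (p : ℝ) ^ (-n : ℤ) := by
  rw [PadicInt.norm_le_pow_iff_mem_span_pow, Ideal.mem_span_singleton]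

lemma PadicInt.isUnit_of_dvd_sub_one {x : ℤ_[p]} (h : (p : ℤ_[p]) ∣ x - 1) : IsUnit x := by
  by_contra hx
  rw [PadicInt.not_isUnit_iff, PadicInt.norm_lt_one_iff_dvd] at hx
  exact PadicInt.prime_p.not_isUnit (isUnit_of_dvd_one ((dvd_sub_right hx).1 h))

lemma exists_one_add_pow_eq {R : Type*} [CommRing R] (x : R) (n : ℕ) :
    ∃ r, (1 + x) ^ n = 1 + n * x + n.choose 2 * x ^ 2 + x ^ 3 * r := by
  induction n with
  | zero => exact ⟨0, by simp⟩
  | succ n ih =>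
    obtain ⟨r, hr⟩ := ih
    refine ⟨n.choose 2 + r * (1 + x), ?_⟩
    rw [pow_succ, hr, Nat.choose_succ_succ' n 1, Nat.choose_one_right]
    push_cast
    ring

lemma PadicInt.sq_dvd_geom_sum_sub {z : ℤ_[p]} (hz : (p : ℤ_[p]) ^ 2 ∣ z - 1) :
    (p : ℤ_[p]) ^ 2 ∣ (∑ i ∈ Finset.range p, z ^ i) - p := by
  have : (∑ i ∈ Finset.range p, z ^ i) - p = ∑ i ∈ Finset.range p, (z ^ i - 1) := by simp
  rw [this]
  exact Finset.dvd_sum fun i _ => hz.trans (sub_one_dvd_pow_sub_one z i)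

/-- A `p`-adic integer congruent to `1` modulo `p ^ (e + 1)` is the `p`-th power of one congruent
to `1` modulo `p ^ e`. -/
lemma PadicInt.exists_pow_prime_eq {e : ℕ} (he : 1 ≤ e) (he2 : p = 2 → 2 ≤ e) {u : ℤ_[p]}
    (hu : (p : ℤ_[p]) ^ (e + 1) ∣ u - 1) :
    ∃ z : ℤ_[p], z ^ p = u ∧ (p : ℤ_[p]) ^ e ∣ z - 1 := by
  have key : ∀ a : ℤ_[p], (p : ℤ_[p]) ∣ a - 1 → (p : ℤ_[p]) ^ 3 ∣ a ^ p - u →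
      ∃ z : ℤ_[p], z ^ p = u ∧ (p : ℤ_[p]) ^ 2 ∣ z - a := by
    intro a ha hau
    have hp1 : (1 : ℝ) < p := by exact_mod_cast hp.out.one_lt
    obtain ⟨z, hz, hza⟩ := PadicInt.exists_pow_eq_of_norm_lt (m := p)
      (PadicInt.isUnit_of_dvd_sub_one ha) (c := u) (by
        rw [PadicInt.pow_dvd_iff_norm_le] at hau
        refine hau.trans_lt ?_
        rw [← norm_pow, PadicInt.norm_p_pow]
        exact zpow_lt_zpow_right₀ hp1 (by norm_num))
    refine ⟨z, hz, ?_⟩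
    rw [PadicInt.pow_dvd_iff_norm_le, PadicInt.norm_le_pow_iff_norm_lt_pow_add_one]
    rw [PadicInt.norm_p] at hza
    simpa using hza
  rcases he.eq_or_lt with rfl | he'
  · have hp2 : 3 ≤ p := by
      have := hp.out.two_le
      rcases this.eq_or_lt with h | h
      · have := he2 h.symm
        omega
      · exact h
    obtain ⟨v, hv⟩ := hu
    obtain ⟨r, hr⟩ := exists_one_add_pow_eq (p * v : ℤ_[p]) p
    obtain ⟨c, hc⟩ := hp.out.dvd_choose_self (k := 2) (by norm_num) hp2
    obtain ⟨z, hz, hza⟩ := key (1 + p * v) (by simp) (by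
      rw [hr, hc, eq_add_of_sub_eq hv]
      refine ⟨c * v ^ 2 + v ^ 3 * r, ?_⟩
      push_cast
      ring)
    refine ⟨z, hz, ?_⟩
    have h1 : (p : ℤ_[p]) ∣ z - (1 + p * v) := (dvd_pow_self _ two_ne_zero).trans hza
    have : z - 1 = z - (1 + p * v) + p * v := by ring
    rw [this, pow_one]
    exact dvd_add h1 (dvd_mul_right _ _)
  · obtain ⟨z, hz, hz1⟩ := key 1 (by simp) (by
      rw [one_pow, ← neg_sub, dvd_neg]
      exact (pow_dvd_pow _ (by omega)).trans hu)
    refine ⟨z, hz, ?_⟩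
    obtain ⟨t, ht⟩ := PadicInt.sq_dvd_geom_sum_sub hz1
    have hg := mul_geom_sum z p
    rw [hz] at hg
    have hs : (∑ i ∈ Finset.range p, z ^ i) = p * (1 + p * t) := by
      rw [eq_add_of_sub_eq ht]; ring
    rw [hs] at hg
    have hU : IsUnit (1 + (p : ℤ_[p]) * t) := PadicInt.isUnit_of_dvd_sub_one (by simp)
    rw [← hg, pow_succ'] at hu
    have : (z - 1) * (p * (1 + p * t)) = p * ((z - 1) * (1 + p * t)) := by ring
    rw [this] at hu
    exact (hU.dvd_mul_right).1 ((mul_dvd_mul_iff_left PadicInt.prime_p.ne_zero).1 hu)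

lemma PadicInt.exists_pow_prime_pow_eq {e : ℕ} (he : 1 ≤ e) (he2 : p = 2 → 2 ≤ e) (n : ℕ)
    {u : ℤ_[p]} (hu : (p : ℤ_[p]) ^ (n + e) ∣ u - 1) :
    ∃ z : ℤ_[p], z ^ p ^ n = u ∧ (p : ℤ_[p]) ∣ z - 1 := by
  induction n generalizing u with
  | zero => exact ⟨u, by simp, (dvd_pow_self _ (by omega)).trans hu⟩
  | succ n ih =>
    obtain ⟨w, hw, hw1⟩ := PadicInt.exists_pow_prime_eq (e := n + e) (by omega) (by grind)
      (u := u) (by convert hu using 2; ring)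
    obtain ⟨z, hz, hz1⟩ := ih hw1
    exact ⟨z, by rw [pow_succ, pow_mul, hz, hw], hz1⟩

/-- A `p`-adic integer congruent to `1` modulo `p ^ ξ(p)` is a `k`-th power. -/
lemma PadicInt.exists_pow_eq_of_dvd_sub_one {k : ℕ} (hk : k ≠ 0) {u : ℤ_[p]}
    (hu : (p : ℤ_[p]) ^ xiExp k p ∣ u - 1) : ∃ z : ℤ_[p], z ^ k = u := by
  obtain ⟨w, hw, hw1⟩ := PadicInt.exists_pow_prime_pow_eq (e := if p = 2 then 2 else 1)
    (by split_ifs <;> norm_num) (by intro h; simp [h]) (k.factorization p) (u := u) (by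
      convert hu using 2
      unfold xiExp
      split_ifs <;> rfl)
  have hm : ‖((k / p ^ k.factorization p : ℕ) : ℤ_[p])‖ = 1 := by
    rw [PadicInt.norm_natCast_eq_one_iff]
    exact Nat.coprime_ordCompl hp.out hk
  obtain ⟨z, hz, -⟩ := PadicInt.exists_pow_eq_of_norm_lt (m := k / p ^ k.factorization p)
    (a := 1) (c := w) isUnit_one (by
      rw [hm, one_pow, one_pow, ← norm_neg, neg_sub, PadicInt.norm_lt_one_iff_dvd]
      exact hw1)
  refine ⟨z, ?_⟩
  rw [← hw, ← hz, ← pow_mul, mul_comm, Nat.ordProj_mul_ordCompl_eq_self]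

lemma PadicInt.exists_pow_eq_of_dvd_sub_pow {k : ℕ} (hk : k ≠ 0) {x c : ℤ_[p]} (hx : IsUnit x)
    (hc : (p : ℤ_[p]) ^ xiExp k p ∣ c - x ^ k) : ∃ z : ℤ_[p], IsUnit z ∧ z ^ k = c := by
  obtain ⟨u, rfl⟩ := hx
  have h1 : (p : ℤ_[p]) ^ xiExp k p ∣ c * ((u⁻¹ : ℤ_[p]ˣ) : ℤ_[p]) ^ k - 1 := by
    have : c * ((u⁻¹ : ℤ_[p]ˣ) : ℤ_[p]) ^ k - 1
        = (c - u ^ k) * ((u⁻¹ : ℤ_[p]ˣ) : ℤ_[p]) ^ k := by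
      rw [sub_mul, ← mul_pow, Units.mul_inv, one_pow]
    rw [this]
    exact hc.mul_right _
  obtain ⟨w, hw⟩ := PadicInt.exists_pow_eq_of_dvd_sub_one hk h1
  have hξ : xiExp k p ≠ 0 := by unfold xiExp; split_ifs <;> omega
  have hwu : IsUnit w := by
    rw [← isUnit_pow_iff hk, hw]
    exact PadicInt.isUnit_of_dvd_sub_one ((dvd_pow_self _ hξ).trans h1)
  refine ⟨u * w, u.isUnit.mul hwu, ?_⟩
  rw [mul_pow, hw, mul_left_comm, ← mul_pow, Units.mul_inv, one_pow, mul_one]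

/-- A solution in `p`-adic units modulo `p ^ ξ(p)` of a diagonal equation with a unit coefficient
lifts to a solution by changing the corresponding coordinate only. -/
lemma PadicInt.exists_diagonal_solution {k s : ℕ} (hk : k ≠ 0) {b y : Fin s → ℤ_[p]} {i : Fin s}
    (hb : IsUnit (b i)) (hy : IsUnit (y i))
    (h : (p : ℤ_[p]) ^ xiExp k p ∣ ∑ j, b j * y j ^ k) :
    ∃ z : ℤ_[p], IsUnit z ∧ ∑ j, b j * Function.update y i z j ^ k = 0 := by
  obtain ⟨v, hv⟩ := hb
  rw [← Finset.add_sum_erase _ _ (Finset.mem_univ i), ← hv] at h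
  set S := ∑ j ∈ Finset.univ.erase i, b j * y j ^ k with hS
  obtain ⟨z, hz, hzk⟩ := PadicInt.exists_pow_eq_of_dvd_sub_pow hk hy
    (c := -(((v⁻¹ : ℤ_[p]ˣ) : ℤ_[p]) * S)) (by
      have : -(((v⁻¹ : ℤ_[p]ˣ) : ℤ_[p]) * S) - y i ^ k
          = -(((v⁻¹ : ℤ_[p]ˣ) : ℤ_[p]) * (v * y i ^ k + S)) := by
        rw [mul_add, Units.inv_mul_cancel_left]; ring
      rw [this, dvd_neg]
      exact h.mul_left _)
  refine ⟨z, hz, ?_⟩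
  rw [← Finset.add_sum_erase _ _ (Finset.mem_univ i), Function.update_self, hzk, ← hv, mul_neg,
    Units.mul_inv_cancel_left, hS, neg_add_eq_zero]
  refine Finset.sum_congr rfl fun j hj => ?_
  rw [Function.update_of_ne (Finset.ne_of_mem_erase hj)]

end PadicRoots

section Counting

variable {p : ℕ} [hp : Fact p.Prime]

lemma PadicInt.isUnit_intCast_iff {z : ℤ} : IsUnit (z : ℤ_[p]) ↔ ¬ (p : ℤ) ∣ z := by
  rw [← not_iff_not, not_not, PadicInt.not_isUnit_iff, PadicInt.norm_intCast_lt_one_iff]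

lemma ZMod.isUnit_intCast_prime_pow_iff {n : ℕ} (hn : n ≠ 0) {z : ℤ} :
    IsUnit (z : ZMod (p ^ n)) ↔ ¬ (p : ℤ) ∣ z := by
  rw [ZMod.coe_int_isUnit_iff_isCoprime, Nat.cast_pow,
    IsCoprime.pow_left_iff (Nat.pos_of_ne_zero hn),
    (Nat.prime_iff_prime_int.1 hp.out).irreducible.coprime_iff_not_dvd]

lemma intCast_diagonal_eq_zero_iff {k s q : ℕ} {a x : Fin s → ℤ} :
    ∑ j, (a j : ZMod q) * (x j : ZMod q) ^ k = 0 ↔ (q : ℤ) ∣ ∑ j, a j * x j ^ k := by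
  rw [← ZMod.intCast_zmod_eq_zero_iff_dvd]
  push_cast
  rfl

lemma exists_int_solution_of_isUnit {k s n : ℕ} (hn : n ≠ 0) {a : Fin s → ℤ}
    {x : Fin s → ZMod (p ^ n)} (hx : ∀ j, IsUnit (x j))
    (h : ∑ j, (a j : ZMod (p ^ n)) * x j ^ k = 0) :
    ∃ y : Fin s → ℤ, (∀ j, ¬ (p : ℤ) ∣ y j) ∧ (p : ℤ) ^ n ∣ ∑ j, a j * y j ^ k := by
  choose y hy using fun j => ZMod.intCast_surjective (x j)
  refine ⟨y, fun j => ?_, ?_⟩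
  · rw [← ZMod.isUnit_intCast_prime_pow_iff hn, hy]
    exact hx j
  · have := (intCast_diagonal_eq_zero_iff (q := p ^ n) (k := k) (a := a) (x := y)).1
      (by simpa only [hy] using h)
    exact_mod_cast this

lemma exists_int_diagonal_solution {k s : ℕ} (hk : k ≠ 0) {b y : Fin s → ℤ} {i : Fin s}
    (hb : ¬ (p : ℤ) ∣ b i) (hy : ¬ (p : ℤ) ∣ y i)
    (h : (p : ℤ) ^ xiExp k p ∣ ∑ j, b j * y j ^ k) (n : ℕ) :
    ∃ z : ℤ, ¬ (p : ℤ) ∣ z ∧ (p : ℤ) ^ n ∣ ∑ j, b j * Function.update y i z j ^ k := by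
  obtain ⟨w, hw, hw0⟩ := PadicInt.exists_diagonal_solution (p := p) hk
    (b := fun j => (b j : ℤ_[p])) (y := fun j => (y j : ℤ_[p])) (i := i)
    (PadicInt.isUnit_intCast_iff.2 hb) (PadicInt.isUnit_intCast_iff.2 hy) (by
      have := (PadicInt.pow_p_dvd_int_iff (p := p) _ _).2 h
      exact_mod_cast this)
  have hwz := PadicInt.appr_spec (n + 1) w
  rw [Ideal.mem_span_singleton] at hwz
  refine ⟨(w.appr (n + 1) : ℕ), ?_, ?_⟩
  · rw [← PadicInt.isUnit_intCast_iff, ← not_not (a := IsUnit _), PadicInt.not_isUnit_iff,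
      PadicInt.norm_lt_one_iff_dvd, Int.cast_natCast]
    intro hd
    have hpw : (p : ℤ_[p]) ∣ w :=
      (dvd_sub_left hd).1 ((dvd_pow_self _ n.succ_ne_zero).trans hwz)
    rw [← PadicInt.norm_lt_one_iff_dvd, ← PadicInt.not_isUnit_iff] at hpw
    exact hpw hw
  · rw [← PadicInt.pow_p_dvd_int_iff, ← dvd_sub_left (c := ∑ j, (b j : ℤ_[p]) *
      Function.update (fun j => (y j : ℤ_[p])) i w j ^ k) (by rw [hw0]; exact dvd_zero _)]
    push_cast
    rw [← Finset.sum_sub_distrib]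
    refine Finset.dvd_sum fun j _ => ?_
    rw [← mul_sub]
    refine Dvd.dvd.mul_left ?_ _
    rcases eq_or_ne j i with rfl | hj
    · rw [Function.update_self, Function.update_self, Int.cast_natCast, ← neg_sub, dvd_neg]
      exact ((pow_dvd_pow _ n.le_succ).trans hwz).trans (sub_dvd_pow_sub_pow _ _ _)
    · rw [Function.update_of_ne hj, Function.update_of_ne hj, sub_self]
      exact dvd_zero _

lemma diagonal_dvd_of_sub_dvd {k s : ℕ} {b x y : Fin s → ℤ} {q : ℤ} (hxy : ∀ j, q ∣ y j - x j)
    (h : q ∣ ∑ j, b j * x j ^ k) : q ∣ ∑ j, b j * y j ^ k := by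
  rw [← dvd_sub_left h, ← Finset.sum_sub_distrib]
  refine Finset.dvd_sum fun j _ => ?_
  rw [← mul_sub]
  exact ((hxy j).trans (sub_dvd_pow_sub_pow _ _ _)).mul_left _

lemma Nat.eq_of_pow_add_dvd_sub {q m n : ℕ} (hq : q ≠ 0) {t t' : ℕ} (ht : t < q ^ m)
    (ht' : t' < q ^ m) (h : (q : ℤ) ^ (n + m) ∣ q ^ n * t - q ^ n * t') : t = t' := by
  rw [pow_add, ← mul_sub, mul_dvd_mul_iff_left (by positivity)] at h
  have := (Int.modEq_iff_dvd.2 h).symm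
  exact Nat.ModEq.eq_of_lt_of_lt (by exact_mod_cast this) ht ht'

lemma le_Mcount {k s : ℕ} (hk : k ≠ 0) {b x : Fin s → ℤ} {i : Fin s}
    (hb : ¬ (p : ℤ) ∣ b i) (hx : ∀ j, ¬ (p : ℤ) ∣ x j)
    (h : (p : ℤ) ^ xiExp k p ∣ ∑ j, b j * x j ^ k) {l n : ℕ} (hn : xiExp k p + l ≤ n) :
    p ^ l * (p ^ (n - xiExp k p)) ^ (s - 1) ≤ Mcount k (fun j => (p : ℤ) ^ l * b j) (p ^ n) := by
  have hξ : xiExp k p ≠ 0 := by unfold xiExp; split_ifs <;> omega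
  set ξ := xiExp k p
  set e : Fin s → ℕ := fun j => if j = i then l else n - ξ with he
  have hcard : Nat.card (∀ j, Fin (p ^ e j)) = p ^ l * (p ^ (n - ξ)) ^ (s - 1) := by
    rw [Nat.card_pi, ← Finset.mul_prod_erase _ _ (Finset.mem_univ i)]
    congr 1
    · simp [he]
    · rw [Finset.prod_congr rfl (g := fun _ => p ^ (n - ξ))]
      · simp
      · intro j hj
        simp [he, Finset.ne_of_mem_erase hj]
  let Y : (∀ j, Fin (p ^ e j)) → Fin s → ℤ :=
    fun t j => if j = i then x i else x j + p ^ ξ * ((t j : ℕ) : ℤ)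
  have hYx : ∀ t j, (p : ℤ) ^ ξ ∣ Y t j - x j := by
    intro t j
    by_cases hj : j = i
    · simp [Y, hj]
    · simp [Y, hj]
  have hY : ∀ t j, ¬ (p : ℤ) ∣ Y t j := fun t j hd =>
    hx j ((dvd_sub_right hd).1 ((dvd_pow_self _ hξ).trans (hYx t j)))
  have hroot : ∀ y : Fin s → ℤ, ∃ z : ℤ, ¬ (p : ℤ) ∣ y i →
      (p : ℤ) ^ ξ ∣ ∑ j, b j * y j ^ k → ¬ (p : ℤ) ∣ z ∧
        (p : ℤ) ^ (n - l) ∣ ∑ j, b j * Function.update y i z j ^ k := by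
    intro y
    by_cases hy : ¬ (p : ℤ) ∣ y i ∧ (p : ℤ) ^ ξ ∣ ∑ j, b j * y j ^ k
    · obtain ⟨z, hz⟩ := exists_int_diagonal_solution hk hb hy.1 hy.2 (n - l)
      exact ⟨z, fun _ _ => hz⟩
    · exact ⟨0, fun h1 h2 => absurd ⟨h1, h2⟩ hy⟩
  choose R hR using hroot
  have hRY : ∀ t, ¬ (p : ℤ) ∣ R (Y t) ∧
      (p : ℤ) ^ (n - l) ∣ ∑ j, b j * Function.update (Y t) i (R (Y t)) j ^ k :=
    fun t => hR _ (hY t i) (diagonal_dvd_of_sub_dvd (hYx t) h)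
  let W : (∀ j, Fin (p ^ e j)) → Fin s → ℤ :=
    fun t => Function.update (Y t) i (R (Y t) + p ^ (n - l) * ((t i : ℕ) : ℤ))
  have hWR : ∀ t j, (p : ℤ) ^ (n - l) ∣ W t j - Function.update (Y t) i (R (Y t)) j := by
    intro t j
    rcases eq_or_ne j i with rfl | hj
    · simp [W]
    · simp [W, Function.update_of_ne hj]
  have hW : ∀ t j, ¬ (p : ℤ) ∣ W t j := by
    intro t j hd
    have := (dvd_sub_right hd).1 ((dvd_pow_self _ (by omega)).trans (hWR t j))
    rcases eq_or_ne j i with rfl | hj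
    · rw [Function.update_self] at this
      exact (hRY t).1 this
    · rw [Function.update_of_ne hj] at this
      exact hY t j this
  have hWsum : ∀ t, (p : ℤ) ^ n ∣ ∑ j, ((p : ℤ) ^ l * b j) * W t j ^ k := by
    intro t
    simp_rw [mul_assoc]
    rw [← Finset.mul_sum, ← Nat.add_sub_of_le (show l ≤ n by omega), pow_add]
    exact mul_dvd_mul_left _ (diagonal_dvd_of_sub_dvd (hWR t) (hRY t).2)
  have hU : ∀ t j, IsUnit (W t j : ZMod (p ^ n)) := fun t j =>
    (ZMod.isUnit_intCast_prime_pow_iff (by omega)).2 (hW t j)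
  have hinj : ∀ t t', (∀ j, (p : ℤ) ^ n ∣ W t j - W t' j) → t = t' := by
    intro t t' htt
    have hoff : ∀ j, j ≠ i → t j = t' j := by
      intro j hj
      have hd := htt j
      have hej : e j = n - ξ := by simp [he, hj]
      simp only [W, Function.update_of_ne hj, Y, if_neg hj, add_sub_add_left_eq_sub] at hd
      refine Fin.ext (Nat.eq_of_pow_add_dvd_sub (n := ξ) hp.out.ne_zero
        (t j).2 (t' j).2 ?_)
      rwa [show ξ + e j = n by omega]
    have hYY : Y t = Y t' := by
      funext j
      by_cases hj : j = i
      · simp [Y, hj]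
      · simp [Y, hj, hoff j hj]
    funext j
    rcases eq_or_ne j i with rfl | hj
    · have hd := htt j
      have hej : e j = l := by simp [he]
      simp only [W, Function.update_self, hYY, add_sub_add_left_eq_sub] at hd
      refine Fin.ext (Nat.eq_of_pow_add_dvd_sub (n := n - l) hp.out.ne_zero
        (t j).2 (t' j).2 ?_)
      rwa [show n - l + e j = n by omega]
    · exact hoff j hj
  rw [← hcard]
  have : NeZero (p ^ n) := ⟨pow_ne_zero _ hp.out.ne_zero⟩
  refine Nat.card_le_card_of_injective (fun t => ⟨fun j => (hU t j).unit, ?_⟩) ?_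
  · simp only [Set.mem_ofPred_eq, IsUnit.unit_spec]
    rw [intCast_diagonal_eq_zero_iff]
    exact_mod_cast hWsum t
  · intro t t' htt
    refine hinj t t' fun j => ?_
    have h1 := congrArg Units.val (congrFun (congrArg Subtype.val htt) j)
    simp only [IsUnit.unit_spec] at h1
    rw [ZMod.intCast_eq_intCast_iff_dvd_sub] at h1
    rw [← neg_sub, dvd_neg]
    exact_mod_cast h1

lemma exists_eq_pow_padicValInt_mul {s : ℕ} {a : Fin s → ℤ} (hg : Finset.univ.gcd a ≠ 0) :
    ∃ b : Fin s → ℤ, (∀ j, a j = (p : ℤ) ^ padicValInt p (Finset.univ.gcd a) * b j) ∧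
      ∃ i, ¬ (p : ℤ) ∣ b i := by
  have hdvd : ∀ j, (p : ℤ) ^ padicValInt p (Finset.univ.gcd a) ∣ a j := fun j =>
    ((padicValInt_dvd_iff _ _).2 (Or.inr le_rfl)).trans (Finset.gcd_dvd (Finset.mem_univ j))
  choose b hb using hdvd
  refine ⟨b, hb, ?_⟩
  by_contra! hcon
  have h1 : (p : ℤ) ^ (padicValInt p (Finset.univ.gcd a) + 1) ∣ Finset.univ.gcd a := by
    refine Finset.dvd_gcd fun j _ => ?_
    rw [pow_succ]
    conv_rhs => rw [hb j]
    exact mul_dvd_mul_left _ (hcon j)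
  rcases (padicValInt_dvd_iff _ _).1 h1 with h0 | h0
  · exact hg h0
  · omega

lemma zpow_le_normalized_count {s ξ l n M : ℕ} (hs : 1 ≤ s) (hn : ξ + l ≤ n)
    (hM : p ^ l * (p ^ (n - ξ)) ^ (s - 1) ≤ M) :
    (p : ℝ) ^ ((l : ℤ) - (ξ : ℤ) * ((s : ℤ) - 1)) ≤
      (p : ℝ) ^ n * ((Nat.totient (p ^ n) : ℝ)) ^ (-(s : ℤ)) * (M : ℝ) := by
  have hp0 : (0 : ℝ) < p := by exact_mod_cast hp.out.pos
  have ht0 : (0 : ℝ) < Nat.totient (p ^ n) := by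
    exact_mod_cast Nat.totient_pos.2 (pow_pos hp.out.pos n)
  have ht : (Nat.totient (p ^ n) : ℝ) ≤ (p : ℝ) ^ n := by exact_mod_cast Nat.totient_le _
  have hM' : (p : ℝ) ^ l * ((p : ℝ) ^ (n - ξ)) ^ (s - 1) ≤ M := by exact_mod_cast hM
  calc (p : ℝ) ^ ((l : ℤ) - (ξ : ℤ) * ((s : ℤ) - 1))
      = (p : ℝ) ^ n * ((p : ℝ) ^ n) ^ (-(s : ℤ)) *
          ((p : ℝ) ^ l * ((p : ℝ) ^ (n - ξ)) ^ (s - 1)) := by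
        simp only [← zpow_natCast, ← zpow_mul, ← zpow_add₀ hp0.ne']
        congr 1
        rw [Nat.cast_sub (by omega : ξ ≤ n), Nat.cast_sub hs]
        push_cast
        ring
    _ ≤ _ := by
        have : ((p : ℝ) ^ n) ^ (-(s : ℤ)) ≤ (Nat.totient (p ^ n) : ℝ) ^ (-(s : ℤ)) := by
          rw [zpow_neg, zpow_neg, zpow_natCast, zpow_natCast]
          gcongr
        gcongr

end Counting

theorem stmt18 (k s : ℕ) (hk : 2 ≤ k) (hs : 5 ≤ s)
    (a : Fin s → ℤ) (ha : ∀ j, a j ≠ 0)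
    (p : ℕ) [hp : Fact p.Prime] (χ : ℝ)
    (hχ : Filter.Tendsto (fun n : ℕ =>
        (p : ℝ) ^ n * ((Nat.totient (p ^ n) : ℝ)) ^ (-(s : ℤ)) *
          (Mcount k a (p ^ n) : ℝ))
      Filter.atTop (nhds χ)) :
    (χ ≠ 0 ↔ ∃ x : Fin s → ℤ_[p], (∀ j, IsUnit (x j)) ∧
        ∑ j, (a j : ℤ_[p]) * x j ^ k = 0) ∧
    (χ ≠ 0 ↔ ∃ x : Fin s → ℤ, (∀ j, ¬ ((p : ℤ) ∣ x j)) ∧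
        (p : ℤ) ^ (xiExp k p + padicValInt p (Finset.univ.gcd a))
          ∣ ∑ j, a j * x j ^ k) ∧
    (χ ≠ 0 →
      (p : ℝ) ^ ((padicValInt p (Finset.univ.gcd a) : ℤ)
          - (xiExp k p : ℤ) * ((s : ℤ) - 1)) ≤ χ) := by
  have hk0 : k ≠ 0 := by omega
  have hξ : xiExp k p ≠ 0 := by unfold xiExp; split_ifs <;> omega
  have hg : Finset.univ.gcd a ≠ 0 := fun h0 =>
    ha ⟨0, by omega⟩ (Finset.gcd_eq_zero_iff.1 h0 _ (Finset.mem_univ _))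
  obtain ⟨b, hab, i, hbi⟩ := exists_eq_pow_padicValInt_mul (p := p) hg
  set l := padicValInt p (Finset.univ.gcd a)
  set ξ := xiExp k p
  have hred : ∀ x : Fin s → ℤ, (p : ℤ) ^ (ξ + l) ∣ ∑ j, a j * x j ^ k →
      (p : ℤ) ^ ξ ∣ ∑ j, b j * x j ^ k := by
    intro x hx
    have hp0 : (p : ℤ) ^ l ≠ 0 := pow_ne_zero _ (by exact_mod_cast hp.out.ne_zero)
    simp_rw [hab, mul_assoc] at hx
    rwa [← Finset.mul_sum, add_comm, pow_add, mul_dvd_mul_iff_left hp0] at hx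
  have hbound : (∃ x : Fin s → ℤ, (∀ j, ¬ ((p : ℤ) ∣ x j)) ∧
      (p : ℤ) ^ (ξ + l) ∣ ∑ j, a j * x j ^ k) →
      (p : ℝ) ^ ((l : ℤ) - (ξ : ℤ) * ((s : ℤ) - 1)) ≤ χ := by
    rintro ⟨x, hx, hxs⟩
    refine ge_of_tendsto hχ ?_
    filter_upwards [Filter.eventually_ge_atTop (ξ + l)] with n hn
    refine zpow_le_normalized_count (by omega) hn ?_
    rw [show a = fun j => (p : ℤ) ^ l * b j from funext hab]
    exact le_Mcount hk0 hbi hx (hred x hxs) hn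
  have hpos : (p : ℝ) ^ ((l : ℤ) - (ξ : ℤ) * ((s : ℤ) - 1)) ≤ χ → χ ≠ 0 := fun h =>
    ((zpow_pos (by exact_mod_cast hp.out.pos) _).trans_le h).ne'
  have hcong : χ ≠ 0 → ∃ x : Fin s → ℤ, (∀ j, ¬ ((p : ℤ) ∣ x j)) ∧
      (p : ℤ) ^ (ξ + l) ∣ ∑ j, a j * x j ^ k := by
    intro h0
    obtain ⟨n, hn, hnl⟩ := ((hχ.eventually_ne h0).and
      (Filter.eventually_ge_atTop (ξ + l))).exists
    have hM : Mcount k a (p ^ n) ≠ 0 := fun hM => hn (by simp [hM])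
    obtain ⟨x, hx⟩ := (Nat.card_ne_zero.1 hM).1
    obtain ⟨y, hy, hys⟩ := exists_int_solution_of_isUnit (n := n) (by omega)
      (fun j => (x j).isUnit) hx
    exact ⟨y, hy, (pow_dvd_pow _ hnl).trans hys⟩
  have hlift : (∃ x : Fin s → ℤ, (∀ j, ¬ ((p : ℤ) ∣ x j)) ∧
      (p : ℤ) ^ (ξ + l) ∣ ∑ j, a j * x j ^ k) →
      ∃ x : Fin s → ℤ_[p], (∀ j, IsUnit (x j)) ∧ ∑ j, (a j : ℤ_[p]) * x j ^ k = 0 := by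
    rintro ⟨x, hx, hxs⟩
    obtain ⟨z, hz, hz0⟩ := PadicInt.exists_diagonal_solution (p := p) hk0
      (b := fun j => (b j : ℤ_[p])) (y := fun j => (x j : ℤ_[p])) (i := i)
      (PadicInt.isUnit_intCast_iff.2 hbi) (PadicInt.isUnit_intCast_iff.2 (hx i)) (by
        have := (PadicInt.pow_p_dvd_int_iff (p := p) _ _).2 (hred x hxs)
        exact_mod_cast this)
    refine ⟨Function.update (fun j => (x j : ℤ_[p])) i z, fun j => ?_, ?_⟩
    · rcases eq_or_ne j i with rfl | hj
      · rwa [Function.update_self]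
      · rw [Function.update_of_ne hj]
        exact PadicInt.isUnit_intCast_iff.2 (hx j)
    · simp_rw [hab, Int.cast_mul, mul_assoc]
      rw [← Finset.mul_sum, hz0, mul_zero]
  have hmod : (∃ x : Fin s → ℤ_[p], (∀ j, IsUnit (x j)) ∧
      ∑ j, (a j : ℤ_[p]) * x j ^ k = 0) →
      ∃ x : Fin s → ℤ, (∀ j, ¬ ((p : ℤ) ∣ x j)) ∧
        (p : ℤ) ^ (ξ + l) ∣ ∑ j, a j * x j ^ k := by
    rintro ⟨x, hx, hx0⟩
    refine exists_int_solution_of_isUnit (n := ξ + l) (by omega)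
      (x := fun j => PadicInt.toZModPow (ξ + l) (x j)) (fun j => (hx j).map _) ?_
    simpa using congrArg (PadicInt.toZModPow (p := p) (ξ + l)) hx0
  exact ⟨⟨fun h => hlift (hcong h), fun h => hpos (hbound (hmod h))⟩,
    ⟨hcong, fun h => hpos (hbound h)⟩, fun h => hbound (hcong h)⟩
end
end
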